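/- arXiv:1404.3409 — 2 statements merged into one kernel-verified Lean document; each statement's English description precedes it below -/
import Mathlib

section
/- Let φ be a weight and let μ be an increasing sequence of positive integers. Then the set U_0^{(μ,φ)}(𝔻) is a dense subset of H(𝔻); in particular there exists f = ∑_{k≥0} a_k z^k ∈ H(𝔻) having Ostrowski-gaps (p_m,q_m)_m with respect to φ, with (p_m)_m a subsequence of μ, a_{p_m} ≠ 0 for every m, a_k = 0 for p_m ≤ k ≤ q_m and all m ≥ 0, and such that for every compact K ⊂ ℂ ∖ 𝔻 with connected complement and every h ∈ A(K), there is a sequence (λ_n)_n of integers with ‖S_{p_{λ_n}}(f) − h‖_K → 0 as n → ∞. -/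
open Polynomial Filter Finset Metric Topology

noncomputable section

/-- Coefficient sequence extended to integer indices, with `a k = 0` for `k < 0`. -/
def acoefZ (a : ℕ → ℂ) (k : ℤ) : ℂ := if 0 ≤ k then a k.toNat else 0

/-- The Hankel determinant `C_{m,n} = det (a_{m-n+1+i+j})_{0 ≤ i,j ≤ n-1}`. -/
def hankelDet (a : ℕ → ℂ) (m n : ℕ) : ℂ :=
  Matrix.det (Matrix.of fun i j : Fin n => acoefZ a ((m : ℤ) - n + 1 + i + j))

/-- `IsPade a m n P Q` : the rational function `P/Q` is the Padé approximant of type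
`(m,n)` of the formal power series `∑ a_k z^k`. -/
def IsPade (a : ℕ → ℂ) (m n : ℕ) (P Q : Polynomial ℂ) : Prop :=
  P.natDegree ≤ m ∧ Q.natDegree ≤ n ∧ IsCoprime P Q ∧ Q.coeff 0 = 1 ∧
    ∀ j ≤ m + n, (∑ i ∈ Finset.range (j + 1), Q.coeff i * a (j - i)) = P.coeff j

/-- `𝒟_{m,n}` : the set of coefficient sequences whose Hankel determinant `C_{m,n}`
does not vanish. -/
def Dset (m n : ℕ) : Set (ℕ → ℂ) := {a | hankelDet a m n ≠ 0}

/-- `𝒩_{m,n}` : the subset of `𝒟_{m,n}` of series whose Padé denominator has exact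
degree `n`. -/
def Nset (m n : ℕ) : Set (ℕ → ℂ) :=
  {a | hankelDet a m n ≠ 0 ∧
    ∃ P Q : Polynomial ℂ, IsPade a m n P Q ∧ Q.degree = (n : WithBot ℕ)}

/-- The open unit disc in `ℂ`. -/
def unitD : Set ℂ := Metric.ball (0 : ℂ) 1

/-- The submodule of `ℂ → ℂ` of functions holomorphic on `Ω` (normalized to vanish
outside `Ω`, so that a function is determined by its restriction to `Ω`). -/
def holSubmodule (Ω : Set ℂ) : Submodule ℂ (ℂ → ℂ) where
  carrier := {f | DifferentiableOn ℂ f Ω ∧ ∀ z ∉ Ω, f z = 0}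
  add_mem' := fun hf hg => ⟨hf.1.add hg.1, fun z hz => by simp [hf.2 z hz, hg.2 z hz]⟩
  zero_mem' := ⟨differentiableOn_const 0, fun _ _ => rfl⟩
  smul_mem' := fun c f hf => ⟨hf.1.const_smul c, fun z hz => by simp [hf.2 z hz]⟩

/-- `H(Ω)`, the space of holomorphic functions on `Ω`. -/
abbrev Hol (Ω : Set ℂ) := ↥(holSubmodule Ω)

/-- The topology of uniform convergence on compact subsets of `Ω` on `H(Ω)`. -/
instance holTop (Ω : Set ℂ) : TopologicalSpace (Hol Ω) :=
  TopologicalSpace.induced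
    (fun f : Hol Ω => UniformOnFun.ofFun {K : Set Ω | IsCompact K} fun z : Ω => f.1 z)
    inferInstance

/-- The `k`-th Taylor coefficient at `0` of a function `f`. -/
def tc (f : ℂ → ℂ) (k : ℕ) : ℂ := iteratedDeriv k f 0 / k.factorial

/-- A weight : a strictly increasing function `φ : ℝ₊ → ℝ₊` with `φ(x) → ∞` and
`φ(x)/x → 0` as `x → ∞`. -/
def IsWeight (φ : ℝ → ℝ) : Prop :=
  StrictMonoOn φ (Set.Ici 0) ∧ (∀ x : ℝ, 0 ≤ x → 0 ≤ φ x) ∧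
    Tendsto φ atTop atTop ∧ Tendsto (fun x => φ x / x) atTop (nhds 0)

/-- The `N`-th Taylor partial sum `S_N(f)` of `f` at `0`, evaluated at `z`. -/
def psum (f : ℂ → ℂ) (N : ℕ) (z : ℂ) : ℂ := ∑ k ∈ Finset.range (N + 1), tc f k * z ^ k

/-- `U0Gaps φ μ f p q` : `f` has Ostrowski-gaps `(p_m, q_m)_m` with respect to the
weight `φ` (i.e. `p_0 < q_0 ≤ p_1 < q_1 ≤ …`, `q_m/p_m → ∞`, `|a_n|^{1/n} → 0` along
the gap set `I = ⋃_m {p_m+1, …, q_m}`, and `p_m < φ(q_m) < q_m`), `(p_m)_m` is a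
subsequence of `μ`, `a_{p_m} ≠ 0` for every `m`, and the Taylor coefficients of `f`
vanish on all the gaps. -/
def U0Gaps (φ : ℝ → ℝ) (μ : ℕ → ℕ) (f : ℂ → ℂ) (p q : ℕ → ℕ) : Prop :=
  (∀ m, 0 < p m) ∧ (∀ m, p m < q m) ∧ (∀ m, q m ≤ p (m + 1)) ∧
  Tendsto (fun m => (q m : ℝ) / (p m : ℝ)) atTop atTop ∧
  (∀ ε : ℝ, 0 < ε → ∃ N : ℕ, ∀ m k, p m < k → k ≤ q m → N ≤ k →
    ‖tc f k‖ ^ ((1 : ℝ) / (k : ℝ)) ≤ ε) ∧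
  (∀ m, (p m : ℝ) < φ (q m) ∧ φ (q m) < (q m : ℝ)) ∧
  (∃ σ : ℕ → ℕ, StrictMono σ ∧ ∀ m, p m = μ (σ m)) ∧
  (∀ m, tc f (p m) ≠ 0) ∧
  (∀ m k, p m < k → k ≤ q m → tc f k = 0)

/-- `U_0^{(μ,φ)}(𝔻)` : the set of `f ∈ H(𝔻)` having Ostrowski-gaps `(p_m, q_m)_m` with
respect to `φ` as in `U0Gaps`, and such that for every compact `K ⊆ ℂ ∖ 𝔻` with
connected complement and every `h ∈ A(K)` there is a sequence `(λ_n)_n` with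
`‖S_{p_{λ_n}}(f) - h‖_K → 0`. -/
def U0set (φ : ℝ → ℝ) (μ : ℕ → ℕ) : Set (Hol unitD) :=
  {f | ∃ p q : ℕ → ℕ, U0Gaps φ μ f.1 p q ∧
    ∀ K : Set ℂ, IsCompact K → Disjoint K unitD → IsConnected Kᶜ →
    ∀ h : ℂ → ℂ, ContinuousOn h K → DifferentiableOn ℂ h (interior K) →
    ∃ lam : ℕ → ℕ,
      TendstoUniformlyOn (fun n z => psum f.1 (p (lam n)) z) h atTop K}

/-- `f` is a uniform limit of polynomials on `K`. -/
def PolyApprox (K : Set ℂ) (f : ℂ → ℂ) : Prop :=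
  ∀ ε : ℝ, 0 < ε → ∃ P : ℂ[X], ∀ z ∈ K, ‖f z - P.eval z‖ < ε

namespace PolyApprox

variable {K : Set ℂ} {f g : ℂ → ℂ}

theorem polynomial (P : ℂ[X]) : PolyApprox K fun z => P.eval z :=
  fun ε hε => ⟨P, fun z _ => by simpa using hε⟩

theorem const (c : ℂ) : PolyApprox K fun _ => c := by
  simpa using polynomial (K := K) (C c)

theorem id : PolyApprox K fun z => z := by
  simpa using polynomial (K := K) X

theorem congr (hf : PolyApprox K f) (h : ∀ z ∈ K, g z = f z) : PolyApprox K g := by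
  intro ε hε
  obtain ⟨P, hP⟩ := hf ε hε
  exact ⟨P, fun z hz => by rw [h z hz]; exact hP z hz⟩

theorem mono {L : Set ℂ} (hf : PolyApprox K f) (h : L ⊆ K) : PolyApprox L f := by
  intro ε hε
  obtain ⟨P, hP⟩ := hf ε hε
  exact ⟨P, fun z hz => hP z (h hz)⟩

/-- A uniform limit of functions that are uniform limits of polynomials is one itself. -/
theorem of_forall_exists (h : ∀ ε : ℝ, 0 < ε → ∃ F, PolyApprox K F ∧ ∀ z ∈ K, ‖f z - F z‖ < ε) :
    PolyApprox K f := by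
  intro ε hε
  obtain ⟨F, hF, hfF⟩ := h (ε / 2) (half_pos hε)
  obtain ⟨P, hP⟩ := hF (ε / 2) (half_pos hε)
  refine ⟨P, fun z hz => ?_⟩
  calc ‖f z - P.eval z‖ ≤ ‖f z - F z‖ + ‖F z - P.eval z‖ := norm_sub_le_norm_sub_add_norm_sub ..
    _ < ε / 2 + ε / 2 := add_lt_add (hfF z hz) (hP z hz)
    _ = ε := add_halves ε

theorem add (hf : PolyApprox K f) (hg : PolyApprox K g) : PolyApprox K fun z => f z + g z := by
  intro ε hε
  obtain ⟨P, hP⟩ := hf (ε / 2) (half_pos hε)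
  obtain ⟨Q, hQ⟩ := hg (ε / 2) (half_pos hε)
  refine ⟨P + Q, fun z hz => ?_⟩
  calc ‖f z + g z - (P + Q).eval z‖ = ‖(f z - P.eval z) + (g z - Q.eval z)‖ := by
        rw [eval_add]; ring_nf
    _ ≤ ‖f z - P.eval z‖ + ‖g z - Q.eval z‖ := norm_add_le _ _
    _ < ε / 2 + ε / 2 := add_lt_add (hP z hz) (hQ z hz)
    _ = ε := add_halves ε

theorem continuousOn (hf : PolyApprox K f) : ContinuousOn f K := by
  choose P hP using fun n : ℕ => hf (1 / ((n : ℝ) + 1)) Nat.one_div_pos_of_nat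
  have : TendstoUniformlyOn (fun n z => (P n).eval z) f atTop K := by
    rw [Metric.tendstoUniformlyOn_iff]
    intro ε hε
    obtain ⟨N, hN⟩ := exists_nat_one_div_lt hε
    filter_upwards [eventually_ge_atTop N] with n hn z hz
    rw [dist_eq_norm]
    exact (hP n z hz).trans_le ((Nat.one_div_le_one_div hn).trans hN.le)
  exact this.continuousOn (Eventually.of_forall fun n => (P n).continuous.continuousOn).frequently

theorem exists_norm_le (hK : IsCompact K) (hf : PolyApprox K f) :
    ∃ M : ℝ, 0 < M ∧ ∀ z ∈ K, ‖f z‖ ≤ M := by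
  obtain ⟨M, hM⟩ := hK.exists_bound_of_continuousOn hf.continuousOn
  exact ⟨max M 1, by positivity, fun z hz => (hM z hz).trans (le_max_left _ _)⟩

theorem mul (hK : IsCompact K) (hf : PolyApprox K f) (hg : PolyApprox K g) :
    PolyApprox K fun z => f z * g z := by
  obtain ⟨M, hM, hfM⟩ := hf.exists_norm_le hK
  refine of_forall_exists fun ε hε => ?_
  obtain ⟨Q, hQ⟩ := hg (ε / M) (by positivity)
  refine ⟨fun z => f z * Q.eval z, fun η hη => ?_, fun z hz => ?_⟩
  · obtain ⟨N, hN, hQN⟩ := (polynomial (K := K) Q).exists_norm_le hK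
    obtain ⟨P, hP⟩ := hf (η / N) (by positivity)
    refine ⟨P * Q, fun z hz => ?_⟩
    rw [eval_mul, ← sub_mul, norm_mul]
    calc _ ≤ ‖f z - P.eval z‖ * N := by gcongr; exact hQN z hz
      _ < η / N * N := by gcongr; exact hP z hz
      _ = η := by field_simp
  · rw [← mul_sub, norm_mul]
    calc _ ≤ M * ‖g z - Q.eval z‖ := by gcongr; exact hfM z hz
      _ < M * (ε / M) := by gcongr; exact hQ z hz
      _ = ε := by field_simp

theorem comp_polynomial (hK : IsCompact K) (hf : PolyApprox K f) (P : ℂ[X]) :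
    PolyApprox K fun z => P.eval (f z) := by
  induction P using Polynomial.induction_on' with
  | add p q hp hq => simpa using hp.add hq
  | monomial n a =>
    induction n with
    | zero => simpa using const (K := K) a
    | succ n ih =>
      refine (ih.mul hK hf).congr fun z _ => ?_
      simp [pow_succ, mul_assoc]

theorem comp (hK : IsCompact K) (hf : PolyApprox K f) (hg : PolyApprox (f '' K) g) :
    PolyApprox K fun z => g (f z) := by
  refine of_forall_exists fun ε hε => ?_
  obtain ⟨P, hP⟩ := hg ε hε
  exact ⟨_, hf.comp_polynomial hK P, fun z hz => hP _ ⟨z, hz, rfl⟩⟩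

/-- Taylor polynomials of a function holomorphic on a disc converge uniformly on smaller discs. -/
theorem of_differentiableOn_ball {R r : ℝ} (hr : r < R) (hf : DifferentiableOn ℂ f (ball 0 R)) :
    PolyApprox (closedBall 0 r) f := by
  intro ε hε
  obtain ⟨s, hs, hsR⟩ := exists_between hr
  by_cases hr0 : r < 0
  · exact ⟨0, fun z hz => absurd hz (by simp [closedBall_eq_empty.2 hr0])⟩
  push Not at hr0
  obtain ⟨t, hrt, hts⟩ := exists_between hs
  lift s to NNReal using by linarith
  lift t to NNReal using by linarith
  have hs0 : 0 < s := by exact_mod_cast hr0.trans_lt hs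
  obtain ⟨p, hps⟩ : ∃ p, HasFPowerSeriesOnBall f p 0 s :=
    ⟨_, (hf.mono (closedBall_subset_ball hsR)).hasFPowerSeriesOnBall hs0⟩
  have := hps.tendstoUniformlyOn' (r' := t) (by exact_mod_cast hts)
  rw [Metric.tendstoUniformlyOn_iff] at this
  obtain ⟨n, hn⟩ := (this ε hε).exists
  refine ⟨∑ k ∈ range n, C (p.coeff k) * X ^ k, fun z hz => ?_⟩
  have := hn z (closedBall_subset_ball hrt hz)
  rw [dist_eq_norm, FormalMultilinearSeries.partialSum] at this
  rw [sub_zero] at this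
  refine lt_of_eq_of_lt (congrArg (fun w => ‖f z - w‖) ?_) this
  rw [eval_finsetSum]
  refine sum_congr rfl fun k _ => ?_
  rw [FormalMultilinearSeries.apply_eq_pow_smul_coeff, smul_eq_mul]
  simp [mul_comm (z ^ k)]

/-- If the complement of `K` is connected then `1 / (z - b)` is a uniform limit of polynomials
on `K` for each `b ∉ K`. -/
theorem inv_sub (hK : IsCompact K) (hKc : IsConnected Kᶜ) {b : ℂ} (hb : b ∉ K) :
    PolyApprox K fun z => (z - b)⁻¹ := by
  have : CompactSpace K := isCompact_iff_compactSpace.1 hK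
  let x : C(K, ℂ) := ⟨fun z => z, continuous_subtype_val⟩
  let S := Algebra.elemental ℂ x
  have hSc : IsClosed (S : Set C(K, ℂ)) := Algebra.elemental.isClosed ℂ x
  have : CompleteSpace S := hSc.completeSpace_coe
  let y : S := ⟨x, Algebra.elemental.self_mem ℂ x⟩
  have hx : spectrum ℂ x = K := by
    rw [ContinuousMap.spectrum_eq_range]; exact Subtype.range_coe
  have hy : spectrum ℂ y = K := by
    have := Subalgebra.spectrum_eq_of_isPreconnected_compl S y
      (by rw [show ((y : S) : C(K, ℂ)) = x from rfl, hx]; exact hKc.isPreconnected)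
    rw [this]; exact hx
  have hu : IsUnit (algebraMap ℂ S b - y) := by
    rw [← spectrum.notMem_iff, hy]; exact hb
  obtain ⟨u, hu⟩ := hu.exists_right_inv
  have hval : ∀ z : K, (z - b)⁻¹ = -(u : C(K, ℂ)) z := by
    intro z
    have h1 := congrArg (fun v : S => (v : C(K, ℂ)) z) hu
    have h2 : (b - z) * (u : C(K, ℂ)) z = 1 := h1
    have h3 : (z : ℂ) - b ≠ 0 := sub_ne_zero.2 fun h => hb (h ▸ z.2)
    field_simp
    linear_combination -h2
  intro ε hε
  have hmem : (u : C(K, ℂ)) ∈ closure (Algebra.adjoin ℂ {x} : Set C(K, ℂ)) := u.2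
  obtain ⟨v, hv, huv⟩ := Metric.mem_closure_iff.1 hmem ε hε
  rw [SetLike.mem_coe, Algebra.adjoin_singleton_eq_range_aeval] at hv
  obtain ⟨P, rfl⟩ := hv
  refine ⟨-P, fun z hz => ?_⟩
  have h1 := hval ⟨z, hz⟩
  have h2 : (aeval x P) ⟨z, hz⟩ = P.eval z := by
    simp [x]
  change ‖(z - b)⁻¹ - _‖ < ε
  rw [h1, eval_neg, ← h2, sub_neg_eq_add, neg_add_eq_sub, ← dist_eq_norm, dist_comm]
  exact (ContinuousMap.dist_apply_le_dist _).trans_lt huv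

end PolyApprox

/-- `s` is a branch of `√((z - p) / (z - b))` on `K` that is a uniform limit of polynomials and is
given by the principal branch far from `b`. -/
structure IsSqrtBranch (K : Set ℂ) (b : ℂ) (r : ℝ) (p : ℂ) (s : ℂ → ℂ) : Prop where
  polyApprox : PolyApprox K s
  sq_mul : ∀ z ∈ K, s z ^ 2 * (z - b) = z - p
  eq_cpow : ∀ z ∈ K, 2 * r ≤ ‖z - b‖ → s z = ((z - p) / (z - b)) ^ (1 / 2 : ℂ)

namespace IsSqrtBranch

variable {K : Set ℂ} {b p p' : ℂ} {r : ℝ} {s : ℂ → ℂ}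

theorem re_div_pos {z : ℂ} (hr : 0 < r) (hp : ‖p - b‖ ≤ r) (hz : 2 * r ≤ ‖z - b‖) :
    0 < ((z - p) / (z - b)).re := by
  have hzb : z - b ≠ 0 := norm_pos_iff.1 (by linarith)
  have h1 : (z - p) / (z - b) = 1 + -((p - b) / (z - b)) := by field_simp; ring
  have h2 : ‖(p - b) / (z - b)‖ ≤ 1 / 2 := by
    rw [norm_div, div_le_iff₀ (by linarith)]
    linarith
  have h3 := (Complex.abs_re_le_norm _).trans h2
  rw [h1, Complex.add_re, Complex.neg_re, Complex.one_re]
  linarith [le_abs_self ((p - b) / (z - b)).re]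

theorem self (hb : b ∉ K) : IsSqrtBranch K b r b fun _ => 1 where
  polyApprox := .const 1
  sq_mul z _ := by ring
  eq_cpow z hz _ := by
    rw [div_self (sub_ne_zero.2 fun h : z = b => hb (h ▸ hz)), Complex.one_cpow]

theorem step (hK : IsCompact K) (hKc : IsConnected Kᶜ) (hr : 0 < r) (hpK : p ∉ K)
    (h : IsSqrtBranch K b r p s) (hp : ‖p - b‖ ≤ r) (hp' : ‖p' - b‖ ≤ r)
    (hpp : ∀ z ∈ K, ‖p' - p‖ < ‖z - p‖) :
    ∃ s', IsSqrtBranch K b r p' s' := by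
  have hzp : ∀ z ∈ K, z - p ≠ 0 := fun z hz => sub_ne_zero.2 fun h => hpK (h ▸ hz)
  have hw : PolyApprox K fun z => (p - p') * (z - p)⁻¹ :=
    (PolyApprox.const _).mul hK (.inv_sub hK hKc hpK)
  have hw1 : ∀ z ∈ K, ‖(p - p') * (z - p)⁻¹‖ < 1 := fun z hz => by
    rw [norm_mul, norm_inv, ← div_eq_mul_inv, div_lt_one (norm_pos_iff.2 (hzp z hz)), norm_sub_rev]
    exact hpp z hz
  obtain ⟨c, hc, hwc⟩ : ∃ c < 1, ∀ z ∈ K, ‖(p - p') * (z - p)⁻¹‖ ≤ c := by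
    rcases K.eq_empty_or_nonempty with rfl | hne
    · exact ⟨0, one_pos, by simp⟩
    · obtain ⟨z, hz, hmax⟩ := hK.exists_isMaxOn hne hw.continuousOn.norm
      exact ⟨_, hw1 z hz, hmax⟩
  have hd : DifferentiableOn ℂ (fun w : ℂ => (1 + w) ^ (1 / 2 : ℂ)) (ball 0 1) := fun w hw =>
    ((differentiableAt_id.const_add 1).cpow_const
      (Complex.mem_slitPlane_of_norm_lt_one (by simpa using hw))).differentiableWithinAt
  have ht := hw.comp hK ((PolyApprox.of_differentiableOn_ball hc hd).mono
    (Set.image_subset_iff.2 fun z hz => by simpa using hwc z hz))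
  have heq : ∀ z ∈ K, 1 + (p - p') * (z - p)⁻¹ = (z - p') / (z - p) := fun z hz => by
    have := hzp z hz
    field_simp
    ring
  refine ⟨_, h.polyApprox.mul hK ht, fun z hz => ?_, fun z hz hzr => ?_⟩
  · have h2 : ((1 + (p - p') * (z - p)⁻¹) ^ (1 / 2 : ℂ)) ^ 2 = (z - p') / (z - p) := by
      rw [one_div, ← heq z hz]
      exact Complex.cpow_nat_inv_pow _ two_ne_zero
    rw [mul_pow, h2, mul_right_comm, h.sq_mul z hz, mul_div_cancel₀ _ (hzp z hz)]
  · have hx := re_div_pos hr hp hzr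
    have hy := re_div_pos hr hp' hzr
    have hzb : z - b ≠ 0 := norm_pos_iff.1 (by linarith)
    have hm : (z - p') / (z - b) = (z - p') / (z - p) * ((z - p) / (z - b)) := by
      have := hzp z hz
      field_simp
    have hq : (z - p') / (z - p) = (z - p') / (z - b) / ((z - p) / (z - b)) := by
      have := hzp z hz
      field_simp
    rw [heq z hz, h.eq_cpow z hz hzr, hq]
    generalize (z - p') / (z - b) = y at hy
    generalize (z - p) / (z - b) = x at hx
    have hx0 : x ≠ 0 := fun h => by simp [h] at hx
    have hy0 : y ≠ 0 := fun h => by simp [h] at hy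
    have ax := abs_lt.1 (Complex.abs_arg_lt_pi_div_two_iff.2 (Or.inl hx))
    have ay := abs_lt.1 (Complex.abs_arg_lt_pi_div_two_iff.2 (Or.inl hy))
    have hyx : y / x ≠ 0 := div_ne_zero hy0 hx0
    have hlog : Complex.log (y / x) = Complex.log y - Complex.log x := by
      have hxpi : x.arg ≠ Real.pi := fun h => by linarith [Real.pi_pos]
      rw [div_eq_mul_inv, Complex.log_mul hy0 (inv_ne_zero hx0), Complex.log_inv x hxpi,
        sub_eq_add_neg]
      rw [Complex.arg_inv, if_neg hxpi]
      exact ⟨by linarith, by linarith⟩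
    rw [Complex.cpow_def_of_ne_zero hx0, Complex.cpow_def_of_ne_zero hy0,
      Complex.cpow_def_of_ne_zero hyx, ← Complex.exp_add, hlog]
    ring_nf

theorem exists_norm_eq (hK : IsCompact K) (hKc : IsConnected Kᶜ) (hb : b ∉ K) (hr : 0 < r) :
    ∃ p s, ‖p - b‖ = r ∧ IsSqrtBranch K b r p s := by
  by_contra! hcon
  let G : Set ℂ := {p | p ∉ K ∧ ‖p - b‖ < r ∧ ∃ s, IsSqrtBranch K b r p s}
  have hdist : ∀ p ∉ K, ∃ η > 0, ∀ z ∈ K, η ≤ ‖z - p‖ := fun p hp => by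
    obtain ⟨η, hη, h⟩ := Metric.isOpen_iff.1 hK.isClosed.isOpen_compl p hp
    refine ⟨η, hη, fun z hz => ?_⟩
    by_contra! hlt
    exact h (mem_ball_iff_norm.2 hlt) hz
  have hGo : IsOpen G := by
    refine Metric.isOpen_iff.2 fun p hp => ?_
    obtain ⟨hpK, hpr, s, hs⟩ := hp
    obtain ⟨η, hη, hηK⟩ := hdist p hpK
    refine ⟨min η (r - ‖p - b‖), lt_min hη (sub_pos.2 hpr), fun q hq => ?_⟩
    rw [mem_ball_iff_norm, lt_min_iff] at hq
    have hqr : ‖q - b‖ < r := by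
      linarith [norm_sub_le_norm_sub_add_norm_sub q p b]
    refine ⟨fun hqK => hq.1.not_ge (hηK q hqK), hqr, ?_⟩
    exact hs.step hK hKc hr hpK hpr.le hqr.le fun z hz => hq.1.trans_le (hηK z hz)
  have hsub : Kᶜ ⊆ G := by
    refine hKc.isPreconnected.subset_of_closure_inter_subset hGo
      ⟨b, hb, hb, by simpa using hr, _, self hb⟩ ?_
    rintro q ⟨hqG, hqK⟩
    obtain ⟨η, hη, hηK⟩ := hdist q hqK
    obtain ⟨p, ⟨hpK, hpr, s, hs⟩, hpq⟩ := Metric.mem_closure_iff.1 hqG (η / 2) (half_pos hη)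
    have hqr : ‖q - b‖ ≤ r := by
      have : closure G ⊆ closedBall b r :=
        closure_minimal (fun x hx => by simpa [dist_eq_norm] using hx.2.1.le) isClosed_closedBall
      simpa [dist_eq_norm] using this hqG
    obtain ⟨s', hs'⟩ := hs.step (p' := q) hK hKc hr hpK hpr.le hqr fun z hz => by
      rw [dist_eq_norm] at hpq
      have := norm_sub_le_norm_sub_add_norm_sub z p q
      rw [norm_sub_rev p q] at this
      linarith [hηK z hz]
    exact ⟨hqK, hqr.lt_of_ne fun h => hcon q s' h hs', s', hs'⟩
  obtain ⟨R, hR⟩ := hK.isBounded.union (isBounded_ball (x := b) (r := r)) |>.subset_closedBall 0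
  obtain ⟨z, hz⟩ : ∃ z : ℂ, R < ‖z‖ := NormedField.exists_lt_norm ℂ R
  have hz' : z ∉ K ∪ ball b r := fun h => by
    have := hR h
    simp at this
    linarith
  exact hz' (Or.inr (mem_ball_iff_norm.2 (hsub fun h => hz' (Or.inl h)).2.1))

end IsSqrtBranch

/-- With `g = 4 x (1 - s)² / p²` and `s² = 1 - p / x`, the combination `g + (ζ - p / 2) g²`
approximates the Cauchy kernel `1 / (x - ζ)` to third order at infinity. -/
theorem norm_kernel_sub_inv_le {r : ℝ} {x p ζ s : ℂ} (hr : 0 < r) (hp : ‖p‖ = r) (hζ : ‖ζ‖ ≤ r)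
    (hs : s ^ 2 * x = x - p) (hfar : 4 * r ≤ ‖x‖ → 0 ≤ s.re) (hx : x ≠ ζ) :
    ‖4 * x * (1 - s) ^ 2 / p ^ 2 + (ζ - p / 2) * (4 * x * (1 - s) ^ 2 / p ^ 2) ^ 2 - (x - ζ)⁻¹‖ ≤
      2000000 * r ^ 2 * (‖x - ζ‖⁻¹ * (r ^ 2 + ‖x - ζ‖ ^ 2)⁻¹) := by
  have hp0 : p ≠ 0 := norm_pos_iff.1 (hp ▸ hr)
  have hd : 0 < ‖x - ζ‖ := norm_pos_iff.2 (sub_ne_zero.2 hx)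
  have hc : ‖ζ - p / 2‖ ≤ 3 / 2 * r := by
    calc ‖ζ - p / 2‖ ≤ ‖ζ‖ + ‖p / 2‖ := norm_sub_le _ _
      _ ≤ r + r / 2 := by rw [norm_div, hp]; norm_num [hζ]
      _ = _ := by ring
  rcases lt_or_ge ‖x‖ (4 * r) with h4 | h4
  · set g := 4 * x * (1 - s) ^ 2 / p ^ 2 with hg
    have hdr : ‖x - ζ‖ ≤ 5 * r := (norm_sub_le _ _).trans (by linarith)
    have hgr : ‖g‖ ≤ 72 / r := by
      have h1 : ‖x‖ * ‖1 - s‖ ^ 2 ≤ 18 * r := by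
        have h2 : ‖1 - s‖ ^ 2 ≤ 2 * (1 + ‖s‖ ^ 2) := by
          have : ‖1 - s‖ ≤ 1 + ‖s‖ := by simpa using norm_sub_le 1 s
          nlinarith [norm_nonneg (1 - s), sq_nonneg (1 - ‖s‖)]
        have h3 : ‖s‖ ^ 2 * ‖x‖ ≤ 5 * r := by
          rw [← norm_pow, ← norm_mul, hs]
          exact (norm_sub_le _ _).trans (by linarith)
        nlinarith [norm_nonneg x]
      rw [hg, norm_div, norm_mul, norm_mul, norm_pow, norm_pow, hp, div_le_div_iff₀ (by positivity) hr]
      simp only [Complex.norm_ofNat]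
      nlinarith
    have h1 : ‖g + (ζ - p / 2) * g ^ 2 - (x - ζ)⁻¹‖ ≤ 7848 / r + ‖x - ζ‖⁻¹ := by
      calc _ ≤ ‖g‖ + ‖ζ - p / 2‖ * ‖g‖ ^ 2 + ‖x - ζ‖⁻¹ := by
            rw [← norm_inv, ← norm_pow, ← norm_mul]
            exact (norm_sub_le _ _).trans (by gcongr; exact norm_add_le _ _)
        _ ≤ 72 / r + 3 / 2 * r * (72 / r) ^ 2 + ‖x - ζ‖⁻¹ := by gcongr
        _ = _ := by field_simp; norm_num; ring
    refine h1.trans ?_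
    generalize ‖x - ζ‖ = d at *
    have h2 : 7848 / r + d⁻¹ ≤ 39241 * d⁻¹ := by
      have : 7848 / r ≤ 39240 * d⁻¹ := by
        rw [← div_eq_mul_inv, div_le_div_iff₀ hr hd]; linarith
      linarith
    refine h2.trans ?_
    have h3 : 1 ≤ 26 * r ^ 2 * (r ^ 2 + d ^ 2)⁻¹ := by
      rw [← div_eq_mul_inv, le_div_iff₀ (by positivity)]
      nlinarith
    have h4 : 0 < d⁻¹ := inv_pos.2 hd
    calc 39241 * d⁻¹ ≤ 39241 * d⁻¹ * (26 * r ^ 2 * (r ^ 2 + d ^ 2)⁻¹) :=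
          le_mul_of_one_le_right (by positivity) h3
      _ = 1020266 * (r ^ 2 * (d⁻¹ * (r ^ 2 + d ^ 2)⁻¹)) := by ring
      _ ≤ 2000000 * (r ^ 2 * (d⁻¹ * (r ^ 2 + d ^ 2)⁻¹)) := by gcongr; norm_num
      _ = _ := by ring
  · have hxr : 0 < ‖x‖ := by linarith
    have hx0 : x ≠ 0 := norm_pos_iff.1 hxr
    have hs1 : 1 ≤ ‖1 + s‖ := by
      refine le_trans ?_ (Complex.re_le_norm _)
      simpa using hfar h4
    have hs0 : 1 + s ≠ 0 := norm_pos_iff.1 (by linarith)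
    set e := 1 - s with he
    have hse : s = 1 - e := by rw [he]; ring
    have hpe : p = x * (e * (2 - e)) := by rw [he]; linear_combination hs
    have hs2 : 1 + s = 2 - e := by rw [he]; ring
    rw [hs2] at hs0 hs1
    have he0 : e ≠ 0 := by rintro h; simp [h] at hpe; exact hp0 hpe
    have hg : 4 * x * e ^ 2 / p ^ 2 = x⁻¹ * (4 / (2 - e) ^ 2) := by
      rw [hpe]; field_simp
    rw [hg]
    have her : ‖e‖ ≤ r / ‖x‖ := by
      rw [le_div_iff₀ hxr, ← hp, hpe, norm_mul, norm_mul, mul_comm]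
      gcongr
      exact le_mul_of_one_le_right (norm_nonneg _) hs1
    have hrx : r / ‖x‖ ≤ 1 / 4 := by rw [div_le_div_iff₀ hxr (by norm_num)]; linarith
    set w := e * (2 - e) with hw
    set G := 4 / (2 - e) ^ 2 with hG
    have hwr : ‖w‖ = r / ‖x‖ := by rw [eq_div_iff hxr.ne', ← hp, hpe, norm_mul x, mul_comm]
    have hE1 : ‖G - 1 - w / 2‖ ≤ 17 / 2 * (r / ‖x‖) ^ 2 := by
      have : G - 1 - w / 2 = e ^ 2 * (5 - 3 * e + e ^ 2 / 2) / (2 - e) ^ 2 := by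
        rw [hG, hw]; field_simp; ring
      rw [this, norm_div, norm_mul, norm_pow, norm_pow]
      refine (div_le_self (by positivity) (one_le_pow₀ hs1)).trans ?_
      have h5 : ‖5 - 3 * e + e ^ 2 / 2‖ ≤ 17 / 2 := by
        calc _ ≤ ‖(5 : ℂ) - 3 * e‖ + ‖e ^ 2 / 2‖ := norm_add_le _ _
          _ ≤ ‖(5 : ℂ)‖ + ‖3 * e‖ + ‖e ^ 2 / 2‖ := by gcongr; exact norm_sub_le _ _
          _ ≤ 17 / 2 := by
            rw [norm_mul, norm_div, norm_pow]; norm_num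
            nlinarith [norm_nonneg e]
      calc _ ≤ (r / ‖x‖) ^ 2 * (17 / 2) := by gcongr
        _ = _ := by ring
    have hE2 : ‖G - 1‖ ≤ 3 * (r / ‖x‖) := by
      calc ‖G - 1‖ = ‖(G - 1 - w / 2) + w / 2‖ := by ring_nf
        _ ≤ 17 / 2 * (r / ‖x‖) ^ 2 + r / ‖x‖ / 2 := by
            refine (norm_add_le _ _).trans (add_le_add hE1 ?_)
            rw [norm_div, hwr]; norm_num
        _ ≤ _ := by nlinarith [div_pos hr hxr]
    have hE3 : ‖G ^ 2 - 1‖ ≤ 9 * (r / ‖x‖) := by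
      have h6 : ‖G + 1‖ ≤ 3 := by
        calc ‖G + 1‖ = ‖(G - 1) + 2‖ := by ring_nf
          _ ≤ ‖G - 1‖ + ‖(2 : ℂ)‖ := norm_add_le _ _
          _ ≤ 3 := by norm_num; linarith
      calc ‖G ^ 2 - 1‖ = ‖G - 1‖ * ‖G + 1‖ := by rw [← norm_mul]; ring_nf
        _ ≤ 3 * (r / ‖x‖) * 3 := by gcongr
        _ = _ := by ring
    have hd34 : 3 / 4 * ‖x‖ ≤ ‖x - ζ‖ := by linarith [norm_sub_norm_le x ζ]
    have hd54 : ‖x - ζ‖ ≤ 5 / 4 * ‖x‖ := by linarith [norm_sub_le x ζ]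
    have hxζ : x - ζ ≠ 0 := sub_ne_zero.2 hx
    have key : x⁻¹ * G + (ζ - p / 2) * (x⁻¹ * G) ^ 2 - (x - ζ)⁻¹ =
        x⁻¹ * (G - 1 - w / 2) + (ζ - p / 2) * (x⁻¹ ^ 2 * (G ^ 2 - 1)) -
          ζ ^ 2 * (x⁻¹ ^ 2 * (x - ζ)⁻¹) := by
      rw [hpe]; field_simp; ring
    have hinv : ‖x - ζ‖⁻¹ ≤ 4 / 3 * ‖x‖⁻¹ := by
      rw [← div_eq_mul_inv, inv_le_comm₀ hd (by positivity)]
      refine le_trans (le_of_eq ?_) hd34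
      field_simp
    have h7 : ‖x⁻¹ * G + (ζ - p / 2) * (x⁻¹ * G) ^ 2 - (x - ζ)⁻¹‖ ≤ 24 * r ^ 2 * ‖x‖⁻¹ ^ 3 := by
      rw [key]
      calc _ ≤ ‖x⁻¹ * (G - 1 - w / 2)‖ + ‖(ζ - p / 2) * (x⁻¹ ^ 2 * (G ^ 2 - 1))‖ +
            ‖ζ ^ 2 * (x⁻¹ ^ 2 * (x - ζ)⁻¹)‖ :=
          (norm_sub_le _ _).trans (by gcongr; exact norm_add_le _ _)
        _ ≤ ‖x‖⁻¹ * (17 / 2 * (r / ‖x‖) ^ 2) + 3 / 2 * r * (‖x‖⁻¹ ^ 2 * (9 * (r / ‖x‖))) +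
            r ^ 2 * (‖x‖⁻¹ ^ 2 * (4 / 3 * ‖x‖⁻¹)) := by
          simp only [norm_mul, norm_pow, norm_inv]
          gcongr
        _ = (17 / 2 + 27 / 2 + 4 / 3) * (r ^ 2 * ‖x‖⁻¹ ^ 3) := by rw [div_eq_mul_inv]; ring
        _ ≤ 24 * (r ^ 2 * ‖x‖⁻¹ ^ 3) := by gcongr; norm_num
        _ = _ := by ring
    refine h7.trans ?_
    have h8 : ‖x‖⁻¹ ≤ 5 / 4 * ‖x - ζ‖⁻¹ := by
      rw [← div_eq_mul_inv, inv_le_comm₀ hxr (by positivity)]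
      refine le_trans (le_of_eq ?_) (show 4 / 5 * ‖x - ζ‖ ≤ ‖x‖ by linarith)
      field_simp
    generalize ‖x - ζ‖ = d at *
    have h9 : d⁻¹ ^ 2 ≤ 2 * (r ^ 2 + d ^ 2)⁻¹ := by
      rw [← div_eq_mul_inv, inv_pow, inv_le_comm₀ (by positivity) (by positivity), inv_div,
        div_le_iff₀ (by norm_num)]
      nlinarith
    calc _ ≤ 24 * r ^ 2 * (5 / 4 * d⁻¹) ^ 3 := by gcongr
      _ = 24 * (5 / 4) ^ 3 * r ^ 2 * (d⁻¹ * d⁻¹ ^ 2) := by ring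
      _ ≤ 24 * (5 / 4) ^ 3 * r ^ 2 * (d⁻¹ * (2 * (r ^ 2 + d ^ 2)⁻¹)) := by gcongr
      _ = 24 * (5 / 4) ^ 3 * 2 * (r ^ 2 * (d⁻¹ * (r ^ 2 + d ^ 2)⁻¹)) := by ring
      _ ≤ 2000000 * (r ^ 2 * (d⁻¹ * (r ^ 2 + d ^ 2)⁻¹)) := by gcongr; norm_num
      _ = _ := by ring

/-- Near each point `b ∉ K` the Cauchy kernels `1 / (z - ζ)`, `ζ ∈ ball b r`, are approximated on
`K` by kernels that depend affinely on `ζ`. -/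
theorem exists_polyApprox_kernel {K : Set ℂ} {b : ℂ} {r : ℝ} (hK : IsCompact K)
    (hKc : IsConnected Kᶜ) (hb : b ∉ K) (hr : 0 < r) :
    ∃ A B : ℂ → ℂ, PolyApprox K A ∧ PolyApprox K B ∧
      ∀ z ∈ K, ∀ ζ ∈ ball b r, z ≠ ζ → ‖A z + ζ * B z - (z - ζ)⁻¹‖ ≤
        2000000 * r ^ 2 * (‖z - ζ‖⁻¹ * (r ^ 2 + ‖z - ζ‖ ^ 2)⁻¹) := by
  obtain ⟨p, s, hp, hs⟩ := IsSqrtBranch.exists_norm_eq hK hKc hb hr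
  have hg : PolyApprox K fun z => 4 * (z - b) * (1 - s z) ^ 2 / (p - b) ^ 2 := by
    have h1 : PolyApprox K fun z => 1 + -1 * s z :=
      (PolyApprox.const 1).add ((PolyApprox.const (-1)).mul hK hs.polyApprox)
    have h2 : PolyApprox K fun z => z + -b := PolyApprox.id.add (.const _)
    refine (((PolyApprox.const (4 / (p - b) ^ 2)).mul hK h2).mul hK (h1.mul hK h1)).congr
      fun z _ => by ring
  refine ⟨_, _, hg.add ((PolyApprox.const (-b - (p - b) / 2)).mul hK (hg.mul hK hg)),
    hg.mul hK hg, fun z hz ζ hζ hzζ => ?_⟩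
  have h := norm_kernel_sub_inv_le (x := z - b) (p := p - b) (ζ := ζ - b) (s := s z) hr hp
    (mem_ball_iff_norm.1 hζ).le (by rw [hs.sq_mul z hz]; ring) (fun h4 => ?_)
    (fun h => hzζ (sub_left_injective h))
  · rw [sub_sub_sub_cancel_right] at h
    refine le_trans (le_of_eq ?_) h
    congr 1
    ring
  · rw [hs.eq_cpow z hz (by linarith), one_div, Complex.cpow_inv_two_re]
    exact Real.sqrt_nonneg _

open MeasureTheory in
theorem integrable_inv_norm_mul_inv_one_add_sq :
    Integrable fun u : ℂ => ‖u‖⁻¹ * (1 + ‖u‖ ^ 2)⁻¹ := by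
  rw [integrable_fun_norm_addHaar volume (f := fun y : ℝ => y⁻¹ * (1 + y ^ 2)⁻¹)]
  refine integrable_inv_one_add_sq.integrableOn.congr_fun (fun y hy => ?_) measurableSet_Ioi
  have : y ≠ 0 := ne_of_gt hy
  simp [Complex.finrank_real_complex, this]

open MeasureTheory in
theorem inv_norm_mul_inv_sq_add_sq_eq {r : ℝ} (hr : 0 < r) (u : ℂ) :
    ‖u‖⁻¹ * (r ^ 2 + ‖u‖ ^ 2)⁻¹ =
      (r ^ 3)⁻¹ * (‖r⁻¹ • u‖⁻¹ * (1 + ‖r⁻¹ • u‖ ^ 2)⁻¹) := by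
  rw [norm_smul, norm_inv, Real.norm_of_nonneg hr.le]
  rcases eq_or_ne u 0 with rfl | hu
  · simp
  · have : ‖u‖ ≠ 0 := norm_ne_zero_iff.2 hu
    field_simp

open MeasureTheory in
theorem integrable_inv_norm_mul_inv_sq_add_sq {r : ℝ} (hr : 0 < r) :
    Integrable fun u : ℂ => ‖u‖⁻¹ * (r ^ 2 + ‖u‖ ^ 2)⁻¹ := by
  simp_rw [inv_norm_mul_inv_sq_add_sq_eq hr]
  exact (integrable_inv_norm_mul_inv_one_add_sq.comp_smul (inv_ne_zero hr.ne')).const_mul _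

open MeasureTheory in
theorem integral_inv_norm_mul_inv_sq_add_sq {r : ℝ} (hr : 0 < r) :
    ∫ u : ℂ, ‖u‖⁻¹ * (r ^ 2 + ‖u‖ ^ 2)⁻¹ = (∫ u : ℂ, ‖u‖⁻¹ * (1 + ‖u‖ ^ 2)⁻¹) / r := by
  simp_rw [inv_norm_mul_inv_sq_add_sq_eq hr]
  rw [integral_const_mul, Measure.integral_comp_inv_smul_of_nonneg volume
    (fun u : ℂ => ‖u‖⁻¹ * (1 + ‖u‖ ^ 2)⁻¹) hr.le, Complex.finrank_real_complex, smul_eq_mul]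
  field_simp

open MeasureTheory in
theorem integrableOn_closedBall_inv_norm (R : ℝ) :
    IntegrableOn (fun u : ℂ => ‖u‖⁻¹) (closedBall 0 R) := by
  refine Integrable.mono' (integrable_inv_norm_mul_inv_one_add_sq.integrableOn.const_mul (1 + R ^ 2))
    (by fun_prop) ?_
  refine (ae_restrict_iff' measurableSet_closedBall).2 (ae_of_all _ fun u hu => ?_)
  rw [mem_closedBall_zero_iff] at hu
  rw [norm_inv, norm_norm, mul_left_comm]
  refine le_mul_of_one_le_right (by positivity) ?_
  rw [← div_eq_mul_inv, one_le_div (by positivity)]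
  gcongr

/-- The average of `∂̄ f` over the disc of radius `δ` about `ζ`, written as a circle integral so that
it makes sense for continuous `f`. -/
def dbarAvg (f : ℂ → ℂ) (δ : ℝ) (ζ : ℂ) : ℂ :=
  (2 * Real.pi * Complex.I * δ ^ 2)⁻¹ * ∮ w in C(ζ, δ), f w

section dbarAvg

variable {f : ℂ → ℂ} {δ : ℝ}

theorem dbarAvg_eq (f : ℂ → ℂ) (δ : ℝ) (ζ : ℂ) :
    dbarAvg f δ ζ = (2 * Real.pi * Complex.I * δ ^ 2)⁻¹ *
      ∫ θ in (0 : ℝ)..2 * Real.pi, circleMap 0 δ θ * Complex.I * f (ζ + circleMap 0 δ θ) := by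
  simp [dbarAvg, circleIntegral, circleMap]

theorem continuous_dbarAvg (hf : Continuous f) : Continuous (dbarAvg f δ) := by
  simp_rw [funext (dbarAvg_eq f δ)]
  refine continuous_const.mul
    (intervalIntegral.continuous_parametric_intervalIntegral_of_continuous' ?_ _ _)
  have := continuous_circleMap 0 δ
  fun_prop

theorem dbarAvg_eq_zero {ζ : ℂ} (h : ∀ w ∈ sphere ζ |δ|, f w = 0) : dbarAvg f δ ζ = 0 := by
  rw [dbarAvg, circleIntegral]
  have : ∀ θ, f (circleMap ζ δ θ) = 0 := fun θ => h _ (circleMap_mem_sphere' ζ δ θ)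
  simp [this]

theorem hasCompactSupport_dbarAvg (hf : HasCompactSupport f) : HasCompactSupport (dbarAvg f δ) := by
  obtain ⟨R, hR⟩ := hf.isCompact.isBounded.subset_closedBall 0
  refine HasCompactSupport.intro (isCompact_closedBall (0 : ℂ) (R + |δ|)) fun ζ hζ => ?_
  refine dbarAvg_eq_zero fun w hw => ?_
  by_contra hne
  have h1 := mem_closedBall_zero_iff.1 (hR (subset_tsupport f hne))
  rw [mem_closedBall_zero_iff, not_le] at hζ
  rw [mem_sphere_iff_norm] at hw
  linarith [norm_sub_norm_le ζ w, norm_sub_rev ζ w]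

theorem norm_dbarAvg_le {ε : ℝ} (hf : Continuous f) (hδ : 0 < δ) {ζ : ℂ}
    (h : ∀ w, ‖w - ζ‖ ≤ δ → ‖f w - f ζ‖ ≤ ε) : ‖dbarAvg f δ ζ‖ ≤ ε / δ := by
  have h1 : ∮ w in C(ζ, δ), f w = ∮ w in C(ζ, δ), (f w - f ζ) := by
    rw [circleIntegral.integral_sub hf.continuousOn.circleIntegrable'
      continuousOn_const.circleIntegrable']
    rw [DiffContOnCl.circleIntegral_eq_zero hδ.le (f := fun _ => f ζ) diffContOnCl_const, sub_zero]
  have h2 : ‖∮ w in C(ζ, δ), (f w - f ζ)‖ ≤ 2 * Real.pi * δ * ε :=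
    circleIntegral.norm_integral_le_of_norm_le_const hδ.le fun w hw =>
      h w (mem_sphere_iff_norm.1 hw).le
  rw [dbarAvg, h1, norm_mul, norm_inv]
  have h3 : ‖(2 * Real.pi * Complex.I * δ ^ 2 : ℂ)‖ = 2 * Real.pi * δ ^ 2 := by
    simp [abs_of_pos Real.pi_pos]
  rw [h3]
  calc _ ≤ (2 * Real.pi * δ ^ 2)⁻¹ * (2 * Real.pi * δ * ε) := by gcongr
    _ = ε / δ := by field_simp

theorem circleIntegral_inv_sub_of_notMem_closedBall {c w : ℂ} {R : ℝ} (hR : 0 ≤ R)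
    (hw : w ∉ closedBall c R) : ∮ z in C(c, R), (z - w)⁻¹ = 0 := by
  have hne : ∀ z ∈ closedBall c R, z - w ≠ 0 := fun z hz h => hw (sub_eq_zero.1 h ▸ hz)
  refine DiffContOnCl.circleIntegral_eq_zero hR (DifferentiableOn.diffContOnCl_ball
    (U := closedBall c R) (fun z hz => ?_) subset_rfl)
  exact ((differentiableAt_id.sub_const w).inv (hne z hz)).differentiableWithinAt

open MeasureTheory in
/-- The integrand of `∫ f (z - u + δ e^{iθ}) / u` is integrable in `(θ, u)`. -/
theorem integrable_circle_kernel (hf : Continuous f) (hfc : HasCompactSupport f) (z : ℂ) :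
    Integrable (Function.uncurry fun (θ : ℝ) (u : ℂ) =>
      circleMap 0 δ θ * Complex.I * f (z - u + circleMap 0 δ θ) * u⁻¹)
      ((volume.restrict (Set.Ioc 0 (2 * Real.pi))).prod volume) := by
  obtain ⟨M, hM⟩ := hfc.exists_bound_of_continuous hf
  obtain ⟨R, hR⟩ := hfc.isCompact.isBounded.subset_closedBall 0
  have hM0 : 0 ≤ M := (norm_nonneg _).trans (hM 0)
  have hb : Integrable (fun x : ℝ × ℂ => |δ| * M *
      (closedBall (0 : ℂ) (R + ‖z‖ + |δ|)).indicator (fun u => ‖u‖⁻¹) x.2)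
      ((volume.restrict (Set.Ioc 0 (2 * Real.pi))).prod volume) :=
    Integrable.mul_prod (f := fun _ : ℝ => |δ| * M)
      (g := (closedBall (0 : ℂ) (R + ‖z‖ + |δ|)).indicator (fun u => ‖u‖⁻¹))
      (integrable_const _)
      ((integrable_indicator_iff measurableSet_closedBall).2 (integrableOn_closedBall_inv_norm _))
  refine hb.mono' ?_ (ae_of_all _ fun x => ?_)
  · have h1 : Continuous fun x : ℝ × ℂ =>
        circleMap 0 δ x.1 * Complex.I * f (z - x.2 + circleMap 0 δ x.1) := by
      have := continuous_circleMap 0 δ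
      fun_prop
    have h2 : Measurable fun x : ℝ × ℂ => x.2⁻¹ := measurable_snd.inv
    exact (h1.measurable.mul h2).aestronglyMeasurable
  · obtain ⟨θ, u⟩ := x
    by_cases hfx : f (z - u + circleMap 0 δ θ) = 0
    · simp only [Function.uncurry, hfx, mul_zero, zero_mul, norm_zero]
      exact mul_nonneg (by positivity)
        (Set.indicator_nonneg (fun _ _ => by positivity) _)
    · have h1 := mem_closedBall_zero_iff.1 (hR (subset_tsupport f hfx))
      have hc : ‖circleMap 0 δ θ‖ = |δ| := norm_circleMap_zero δ θ
      have hu : u ∈ closedBall (0 : ℂ) (R + ‖z‖ + |δ|) := by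
        rw [mem_closedBall_zero_iff]
        calc ‖u‖ = ‖z + circleMap 0 δ θ - (z - u + circleMap 0 δ θ)‖ := by ring_nf
          _ ≤ ‖z‖ + ‖circleMap 0 δ θ‖ + ‖z - u + circleMap 0 δ θ‖ :=
            (norm_sub_le _ _).trans (by gcongr; exact norm_add_le _ _)
          _ ≤ _ := by rw [hc]; linarith
      simp only [Function.uncurry, Set.indicator_of_mem hu, norm_mul, norm_inv, hc, Complex.norm_I,
        mul_one]
      gcongr
      exact hM _

open MeasureTheory in
theorem dbarAvg_sub_mul_inv_eq (z u : ℂ) : dbarAvg f δ (z - u) * u⁻¹ =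
    (2 * Real.pi * Complex.I * δ ^ 2)⁻¹ * ∫ θ in Set.Ioc 0 (2 * Real.pi),
      circleMap 0 δ θ * Complex.I * f (z - u + circleMap 0 δ θ) * u⁻¹ := by
  rw [dbarAvg_eq, intervalIntegral.integral_of_le (by positivity), mul_assoc, ← integral_mul_const]

open MeasureTheory in
theorem integrable_dbarAvg_mul_inv (hf : Continuous f) (hfc : HasCompactSupport f) (z : ℂ) :
    Integrable fun ζ => dbarAvg f δ ζ * (z - ζ)⁻¹ := by
  have h : Integrable fun u => dbarAvg f δ (z - u) * u⁻¹ := by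
    simp_rw [dbarAvg_sub_mul_inv_eq]
    exact (integrable_circle_kernel hf hfc z).integral_prod_right.const_mul _
  simpa using h.comp_sub_left z

open MeasureTheory in
/-- The Cauchy transform of the averaged `∂̄ f` is the average of `f` over discs of radius `δ`. -/
theorem integral_dbarAvg_mul_inv (hf : Continuous f) (hfc : HasCompactSupport f) (hδ : 0 < δ)
    (z : ℂ) : ∫ ζ, dbarAvg f δ ζ * (z - ζ)⁻¹ = (δ ^ 2 : ℂ)⁻¹ * ∫ w in ball z δ, f w := by
  have hH := integrable_circle_kernel (δ := δ) hf hfc z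
  have h0 : ∫ ζ, dbarAvg f δ ζ * (z - ζ)⁻¹ = ∫ u, dbarAvg f δ (z - u) * u⁻¹ := by
    rw [← integral_sub_left_eq_self (fun ζ => dbarAvg f δ ζ * (z - ζ)⁻¹) volume z]
    simp
  have hshift : ∀ θ, (fun v => circleMap 0 δ θ * Complex.I * f (z - v) * (v + circleMap 0 δ θ)⁻¹) =
      fun v => (fun u => circleMap 0 δ θ * Complex.I * f (z - u + circleMap 0 δ θ) * u⁻¹)
        (v + circleMap 0 δ θ) := by
    intro θ
    ext v
    ring_nf
  have h1 : ∀ θ, ∫ u, circleMap 0 δ θ * Complex.I * f (z - u + circleMap 0 δ θ) * u⁻¹ =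
      ∫ v, circleMap 0 δ θ * Complex.I * f (z - v) * (v + circleMap 0 δ θ)⁻¹ := by
    intro θ
    rw [hshift, integral_add_right_eq_self
      (fun u => circleMap 0 δ θ * Complex.I * f (z - u + circleMap 0 δ θ) * u⁻¹)]
  have hH' : Integrable (Function.uncurry fun (θ : ℝ) (v : ℂ) =>
      circleMap 0 δ θ * Complex.I * f (z - v) * (v + circleMap 0 δ θ)⁻¹)
      ((volume.restrict (Set.Ioc 0 (2 * Real.pi))).prod volume) := by
    have hm : AEStronglyMeasurable (Function.uncurry fun (θ : ℝ) (v : ℂ) =>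
        circleMap 0 δ θ * Complex.I * f (z - v) * (v + circleMap 0 δ θ)⁻¹)
        ((volume.restrict (Set.Ioc 0 (2 * Real.pi))).prod volume) := by
      have hc := continuous_circleMap 0 δ
      have h1 : Continuous fun x : ℝ × ℂ => circleMap 0 δ x.1 * Complex.I * f (z - x.2) := by
        fun_prop
      have h2 : Continuous fun x : ℝ × ℂ => x.2 + circleMap 0 δ x.1 := by fun_prop
      exact (h1.measurable.mul h2.measurable.inv).aestronglyMeasurable
    rw [integrable_prod_iff hm]
    refine ⟨?_, ?_⟩
    · filter_upwards [((integrable_prod_iff hH.1).1 hH).1] with θ hθ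
      simp only [Function.uncurry] at hθ ⊢
      rw [hshift]
      exact hθ.comp_add_right _
    · refine hH.integral_norm_prod_left.congr (ae_of_all _ fun θ => ?_)
      simp only [Function.uncurry]
      rw [← integral_add_right_eq_self
        (fun u => ‖circleMap 0 δ θ * Complex.I * f (z - u + circleMap 0 δ θ) * u⁻¹‖)
        (circleMap 0 δ θ)]
      exact integral_congr_ae (ae_of_all _ fun v =>
        congrArg norm (congrFun (hshift θ) v).symm)
  have h2 : ∀ v : ℂ, ‖v‖ ≠ δ → ∫ θ in Set.Ioc 0 (2 * Real.pi),
      circleMap 0 δ θ * Complex.I * f (z - v) * (v + circleMap 0 δ θ)⁻¹ =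
      (ball (0 : ℂ) δ).indicator (fun v => 2 * Real.pi * Complex.I * f (z - v)) v := by
    intro v hv
    have h3 : ∫ θ in Set.Ioc 0 (2 * Real.pi),
        circleMap 0 δ θ * Complex.I * f (z - v) * (v + circleMap 0 δ θ)⁻¹ =
        f (z - v) * ∮ w in C(0, δ), (w - -v)⁻¹ := by
      rw [circleIntegral, intervalIntegral.integral_of_le (by positivity), ← integral_const_mul]
      congr 1
      ext θ
      simp only [deriv_circleMap, smul_eq_mul, sub_neg_eq_add]
      ring_nf
    rw [h3]
    rcases lt_or_gt_of_ne hv with h | h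
    · rw [circleIntegral.integral_sub_inv_of_mem_ball (by simpa using h),
        Set.indicator_of_mem (by simpa using h)]
      ring
    · rw [circleIntegral_inv_sub_of_notMem_closedBall hδ.le (by simpa using h),
        Set.indicator_of_notMem (by simpa using h.le), mul_zero]
  have hae : ∀ᵐ v : ℂ, ‖v‖ ≠ δ := by
    have := Measure.addHaar_sphere volume (0 : ℂ) δ
    rw [← compl_mem_ae_iff] at this
    filter_upwards [this] with v hv h
    exact hv (mem_sphere_zero_iff_norm.2 h)
  have h4 : ∫ v in ball (0 : ℂ) δ, f (z - v) = ∫ w in ball z δ, f w := by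
    rw [← integral_indicator measurableSet_ball, ← integral_indicator measurableSet_ball,
      ← integral_sub_left_eq_self ((ball z δ).indicator f) volume z]
    congr 1
    ext v
    simp [Set.indicator, dist_eq_norm]
  have hδ0 : (δ : ℂ) ≠ 0 := by exact_mod_cast hδ.ne'
  rw [h0]
  simp_rw [dbarAvg_sub_mul_inv_eq]
  rw [integral_const_mul, ← integral_integral_swap hH]
  simp_rw [h1]
  rw [integral_integral_swap hH', integral_congr_ae (hae.mono h2),
    integral_indicator measurableSet_ball, integral_const_mul, h4]
  have hpi : (Real.pi : ℂ) ≠ 0 := by exact_mod_cast Real.pi_ne_zero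
  have hI := Complex.I_ne_zero
  field_simp

open MeasureTheory in
theorem norm_integral_dbarAvg_sub_le {ε : ℝ} (hf : Continuous f) (hfc : HasCompactSupport f)
    (hδ : 0 < δ) {z : ℂ} (h : ∀ w, ‖w - z‖ ≤ δ → ‖f w - f z‖ ≤ ε) :
    ‖(Real.pi : ℂ)⁻¹ * (∫ ζ, dbarAvg f δ ζ * (z - ζ)⁻¹) - f z‖ ≤ ε := by
  have hvol : volume.real (ball z δ) = Real.pi * δ ^ 2 := by
    rw [measureReal_def, Complex.volume_ball]
    simp [hδ.le, mul_comm]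
  have hfin : volume (ball z δ) < ⊤ := measure_ball_lt_top
  have hδ0 : (δ : ℂ) ≠ 0 := by exact_mod_cast hδ.ne'
  have hpi : (Real.pi : ℂ) ≠ 0 := by exact_mod_cast Real.pi_ne_zero
  have hint : IntegrableOn f (ball z δ) := (hf.integrable_of_hasCompactSupport hfc).integrableOn
  have h1 : ∫ w in ball z δ, (f w - f z) = (∫ w in ball z δ, f w) - Real.pi * δ ^ 2 * f z := by
    rw [integral_sub hint (integrableOn_const hfin.ne), setIntegral_const, hvol]
    simp
  have h2 : ‖∫ w in ball z δ, (f w - f z)‖ ≤ ε * (Real.pi * δ ^ 2) := by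
    rw [← hvol]
    exact norm_setIntegral_le_of_norm_le_const hfin fun w hw =>
      h w (mem_ball_iff_norm.1 hw).le
  have h3 : (Real.pi : ℂ)⁻¹ * (∫ ζ, dbarAvg f δ ζ * (z - ζ)⁻¹) - f z =
      ((Real.pi * δ ^ 2 : ℝ) : ℂ)⁻¹ * ∫ w in ball z δ, (f w - f z) := by
    rw [integral_dbarAvg_mul_inv hf hfc hδ, h1]
    push_cast
    field_simp
  rw [h3, norm_mul, norm_inv, Complex.norm_real, Real.norm_of_nonneg (by positivity)]
  calc _ ≤ (Real.pi * δ ^ 2)⁻¹ * (ε * (Real.pi * δ ^ 2)) := by gcongr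
    _ = ε := by field_simp

end dbarAvg

open MeasureTheory in
/-- A continuous density `G` carried by points close to `Kᶜ` has a Cauchy transform that
is close on `K` to a uniform limit of polynomials. -/
theorem exists_polyApprox_cauchyTransform {K : Set ℂ} {G : ℂ → ℂ} {r M : ℝ} (hK : IsCompact K)
    (hKc : IsConnected Kᶜ) (hr : 0 < r) (hG : Continuous G) (hGc : HasCompactSupport G)
    (hGK : ∀ ζ ∈ tsupport G, ∃ b ∉ K, ζ ∈ ball b r) (hM : ∀ ζ, ‖G ζ‖ ≤ M)
    (hint : ∀ z, Integrable fun ζ => G ζ * (z - ζ)⁻¹) :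
    ∃ F, PolyApprox K F ∧ ∀ z ∈ K, ‖F z - ∫ ζ, G ζ * (z - ζ)⁻¹‖ ≤
      2000000 * (M * r) * ∫ u : ℂ, ‖u‖⁻¹ * (1 + ‖u‖ ^ 2)⁻¹ := by
  have hM0 : 0 ≤ M := (norm_nonneg _).trans (hM 0)
  let κ : ℂ → ℝ := fun u => M * (2000000 * r ^ 2 * (‖u‖⁻¹ * (r ^ 2 + ‖u‖ ^ 2)⁻¹))
  have hκ : Integrable κ := ((integrable_inv_norm_mul_inv_sq_add_sq hr).const_mul _).const_mul _
  have hκz : ∀ z, Integrable fun ζ => κ (z - ζ) := fun z => hκ.comp_sub_left z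
  have hκ0 : ∀ u, 0 ≤ κ u := fun u => by positivity
  have hGi : Integrable G := hG.integrable_of_hasCompactSupport hGc
  have hGi' : Integrable fun ζ => G ζ * ζ :=
    (hG.mul continuous_id).integrable_of_hasCompactSupport hGc.mul_right
  have main : ∃ T, MeasurableSet T ∧ tsupport G ⊆ T ∧ ∀ Y ⊆ T, MeasurableSet Y → ∃ F,
      PolyApprox K F ∧ ∀ z ∈ K, ‖F z - ∫ ζ in Y, G ζ * (z - ζ)⁻¹‖ ≤ ∫ ζ in Y, κ (z - ζ) := by
    refine hGc.isCompact.induction_on (p := fun X => ∃ T, MeasurableSet T ∧ X ⊆ T ∧ ∀ Y ⊆ T,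
      MeasurableSet Y → ∃ F, PolyApprox K F ∧
      ∀ z ∈ K, ‖F z - ∫ ζ in Y, G ζ * (z - ζ)⁻¹‖ ≤ ∫ ζ in Y, κ (z - ζ)) ?_ ?_ ?_ ?_
    · refine ⟨∅, .empty, subset_rfl, fun Y hY _ => ?_⟩
      rw [Set.subset_empty_iff.1 hY]
      exact ⟨fun _ => 0, .const 0, fun z _ => by simp⟩
    · exact fun s t hst ⟨T, hT, htT, h⟩ => ⟨T, hT, hst.trans htT, h⟩
    · rintro s t ⟨S, hS, hsS, hs⟩ ⟨T, hT, htT, ht⟩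
      refine ⟨S ∪ T, hS.union hT, Set.union_subset_union hsS htT, fun Y hY hYm => ?_⟩
      obtain ⟨F₁, hF₁, hF₁z⟩ := hs (Y ∩ S) Set.inter_subset_right (hYm.inter hS)
      obtain ⟨F₂, hF₂, hF₂z⟩ := ht (Y \ S) (Set.sdiff_subset_iff.2 hY) (hYm.diff hS)
      refine ⟨_, hF₁.add hF₂, fun z hz => ?_⟩
      rw [← integral_inter_add_sdiff hS (hint z).integrableOn,
        ← integral_inter_add_sdiff hS (hκz z).integrableOn, add_sub_add_comm]
      exact (norm_add_le _ _).trans (add_le_add (hF₁z z hz) (hF₂z z hz))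
    · intro ζ₀ hζ₀
      obtain ⟨b, hb, hζb⟩ := hGK ζ₀ hζ₀
      obtain ⟨A, B, hA, hB, hAB⟩ := exists_polyApprox_kernel hK hKc hb hr
      refine ⟨ball b r, mem_nhdsWithin_of_mem_nhds (isOpen_ball.mem_nhds hζb), ball b r,
        measurableSet_ball, subset_rfl, fun Y hY hYm => ?_⟩
      refine ⟨_, ((PolyApprox.const (∫ ζ in Y, G ζ)).mul hK hA).add
        ((PolyApprox.const (∫ ζ in Y, G ζ * ζ)).mul hK hB), fun z hz => ?_⟩
      have h1 : (∫ ζ in Y, G ζ) * A z + (∫ ζ in Y, G ζ * ζ) * B z - ∫ ζ in Y, G ζ * (z - ζ)⁻¹ =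
          ∫ ζ in Y, G ζ * (A z + ζ * B z - (z - ζ)⁻¹) := by
        rw [← integral_mul_const, ← integral_mul_const, ← integral_add, ← integral_sub]
        · congr 1
          ext ζ
          ring
        · exact ((hGi.mul_const _).add (hGi'.mul_const _)).integrableOn
        · exact (hint z).integrableOn
        · exact (hGi.mul_const _).integrableOn
        · exact (hGi'.mul_const _).integrableOn
      rw [h1]
      refine norm_integral_le_of_norm_le (hκz z).integrableOn ?_
      have hne : ∀ᵐ ζ ∂volume.restrict Y, ζ ≠ z :=
        ae_restrict_of_ae (by simp [ae_iff])
      filter_upwards [hne, ae_restrict_mem hYm] with ζ hζ hζY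
      rw [norm_mul]
      exact mul_le_mul (hM ζ) (hAB z hz ζ (hY hζY) hζ.symm) (norm_nonneg _) hM0
  obtain ⟨T, -, hGT, hT⟩ := main
  obtain ⟨F, hF, hFz⟩ := hT _ hGT (isClosed_tsupport G).measurableSet
  refine ⟨F, hF, fun z hz => ?_⟩
  have h1 := hFz z hz
  rw [setIntegral_eq_integral_of_forall_compl_eq_zero fun ζ hζ => by
    rw [image_eq_zero_of_notMem_tsupport hζ, zero_mul]] at h1
  refine h1.trans ((setIntegral_le_integral (hκz z) (ae_of_all _ fun ζ => hκ0 _)).trans ?_)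
  rw [integral_sub_left_eq_self κ volume z, integral_const_mul, integral_const_mul,
    integral_inv_norm_mul_inv_sq_add_sq hr]
  refine le_of_eq ?_
  field_simp

/-- **Mergelyan's theorem** for functions with compact support on the plane. -/
theorem polyApprox_of_hasCompactSupport {K : Set ℂ} {f : ℂ → ℂ} (hK : IsCompact K)
    (hKc : IsConnected Kᶜ) (hf : Continuous f) (hfc : HasCompactSupport f)
    (hd : DifferentiableOn ℂ f (interior K)) : PolyApprox K f := by
  set c : ℝ := ∫ u : ℂ, ‖u‖⁻¹ * (1 + ‖u‖ ^ 2)⁻¹ with hc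
  have hc0 : 0 ≤ c := MeasureTheory.integral_nonneg fun u => by positivity
  refine PolyApprox.of_forall_exists fun η hη => ?_
  set D : ℝ := Real.pi⁻¹ * (4000000 * c) + 2 with hD
  have hD0 : 0 < D := by positivity
  set ε : ℝ := η / D with hε
  have hε0 : 0 < ε := by positivity
  obtain ⟨δ', hδ', hfδ'⟩ := Metric.uniformContinuous_iff.1
    (hfc.uniformContinuous_of_continuous hf) ε hε0
  set δ := δ' / 2 with hδ_def
  have hδ : 0 < δ := half_pos hδ'
  have hfδ : ∀ z w, ‖w - z‖ ≤ δ → ‖f w - f z‖ ≤ ε := fun z w h => by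
    rw [← dist_eq_norm]
    exact (hfδ' (by rw [dist_eq_norm]; linarith)).le
  have hGK : ∀ ζ ∈ tsupport (dbarAvg f δ), ∃ b ∉ K, ζ ∈ ball b (2 * δ) := by
    intro ζ hζ
    obtain ⟨ζ₁, hζ₁, hd1⟩ := Metric.mem_closure_iff.1 hζ δ hδ
    obtain ⟨b, hb, hbK⟩ : ∃ b ∈ closedBall ζ₁ δ, b ∉ K := by
      by_contra! hsub
      refine hζ₁ ?_
      rw [dbarAvg, DiffContOnCl.circleIntegral_eq_zero hδ.le, mul_zero]
      exact ⟨hd.mono (interior_maximal (ball_subset_closedBall.trans hsub) isOpen_ball),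
        hf.continuousOn⟩
    refine ⟨b, hbK, ?_⟩
    rw [mem_closedBall, dist_comm] at hb
    rw [mem_ball]
    linarith [dist_triangle ζ ζ₁ b]
  obtain ⟨F, hF, hFz⟩ := exists_polyApprox_cauchyTransform hK hKc (by linarith : 0 < 2 * δ)
    (continuous_dbarAvg hf) (hasCompactSupport_dbarAvg hfc) hGK
    (fun ζ => norm_dbarAvg_le hf hδ (hfδ ζ)) (integrable_dbarAvg_mul_inv hf hfc)
  refine ⟨_, (PolyApprox.const (Real.pi : ℂ)⁻¹).mul hK hF, fun z hz => ?_⟩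
  have h1 := norm_integral_dbarAvg_sub_le hf hfc hδ (hfδ z)
  have h2 := hFz z hz
  set Φ := ∫ ζ, dbarAvg f δ ζ * (z - ζ)⁻¹ with hΦ
  calc ‖f z - (Real.pi : ℂ)⁻¹ * F z‖
      = ‖(Real.pi : ℂ)⁻¹ * (F z - Φ) + ((Real.pi : ℂ)⁻¹ * Φ - f z)‖ := by
        rw [norm_sub_rev]; ring_nf
    _ ≤ Real.pi⁻¹ * (2000000 * (ε / δ * (2 * δ)) * c) + ε := by
        refine (norm_add_le _ _).trans (add_le_add ?_ h1)
        rw [norm_mul, norm_inv, Complex.norm_real, Real.norm_of_nonneg Real.pi_pos.le]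
        gcongr
    _ = ε * (Real.pi⁻¹ * (4000000 * c) + 1) := by field_simp; ring
    _ < ε * D := by gcongr; linarith
    _ = η := by rw [hε]; field_simp

/-- **Mergelyan's theorem**: if `K` is compact with connected complement, each continuous function
on `K` that is holomorphic in the interior of `K` is a uniform limit of polynomials on `K`. -/
theorem polyApprox_of_continuousOn {K : Set ℂ} {f : ℂ → ℂ} (hK : IsCompact K)
    (hKc : IsConnected Kᶜ) (hf : ContinuousOn f K) (hd : DifferentiableOn ℂ f (interior K)) :
    PolyApprox K f := by
  obtain ⟨g, hg⟩ := ContinuousMap.exists_restrict_eq hK.isClosed ⟨K.domRestrict f, hf.domRestrict⟩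
  obtain ⟨χ, hχK, -, hχc, -⟩ :=
    exists_continuous_one_zero_of_isCompact hK isClosed_empty (Set.disjoint_empty K)
  have heq : Set.EqOn f (fun z => (χ z : ℂ) * g z) K := fun z hz => by
    have h1 : g z = f z := congrArg (fun F : C(K, ℂ) => F ⟨z, hz⟩) hg
    have h2 : χ z = 1 := hχK hz
    simp [h1, h2]
  refine (polyApprox_of_hasCompactSupport hK hKc (by fun_prop) ?_
    (hd.congr fun z hz => (heq (interior_subset hz)).symm)).congr heq
  exact (hχc.comp_left (g := fun x : ℝ => (x : ℂ)) (by simp)).mul_right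

theorem isConnected_setOf_norm_mem {s : Set ℝ} (hs : IsConnected s) (h0 : ∀ t ∈ s, 0 ≤ t) :
    IsConnected {z : ℂ | ‖z‖ ∈ s} := by
  have h1 : IsConnected (s ×ˢ sphere (0 : ℂ) 1) :=
    hs.prod (isConnected_sphere (by simp) 0 zero_le_one)
  convert! h1.image (fun x => (x.1 : ℂ) * x.2) (by fun_prop) using 1
  ext z
  simp only [Set.mem_ofPred_eq, Set.mem_image, Set.mem_prod, mem_sphere_zero_iff_norm, Prod.exists]
  constructor
  · intro hz
    rcases eq_or_ne z 0 with rfl | hz0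
    · exact ⟨0, 1, by simpa using hz, by simp⟩
    · exact ⟨‖z‖, z / ‖z‖, ⟨hz, by
        rw [norm_div, Complex.norm_real, norm_norm, div_self (norm_ne_zero_iff.2 hz0)]⟩, by
        rw [mul_div_cancel₀ _ (by simpa using hz0)]⟩
  · rintro ⟨t, u, ⟨ht, hu⟩, rfl⟩
    simpa [hu, abs_of_nonneg (h0 t ht)] using ht

/-- Removing a smaller disc from a connected open set containing the unit disc leaves
a connected set. -/
theorem isConnected_compl_union_closedBall {K : Set ℂ} {r : ℝ} (hK : IsClosed K)
    (hKc : IsConnected Kᶜ) (hd : Disjoint K unitD) (hr0 : 0 ≤ r) (hr : r < 1) :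
    IsConnected (K ∪ closedBall 0 r)ᶜ := by
  set A : Set ℂ := {z | ‖z‖ ∈ Set.Ioo r 1} with hA
  have hAc : IsConnected A := isConnected_setOf_norm_mem (isConnected_Ioo hr) fun t ht =>
    hr0.trans ht.1.le
  have hDK : ball (0 : ℂ) 1 ⊆ Kᶜ := (show Disjoint K (ball 0 1) from hd).subset_compl_left
  have hAD : A ⊆ ball 0 1 := fun z hz => by simpa using hz.2
  have hA' : ball (0 : ℂ) 1 ⊆ closedBall 0 r ∪ A := fun z hz => by
    rcases le_or_gt ‖z‖ r with h | h
    · exact Or.inl (by simpa using h)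
    · exact Or.inr ⟨h, by simpa using hz⟩
  set W : Set ℂ := (K ∪ closedBall 0 r)ᶜ with hW
  have hWo : IsOpen W := (hK.union isClosed_closedBall).isOpen_compl
  have hAW : A ⊆ W := fun z hz => by
    rw [hW, Set.mem_compl_iff, Set.mem_union, not_or]
    exact ⟨hDK (hAD hz), by simpa using hz.1⟩
  have hWK : W ⊆ Kᶜ := Set.compl_subset_compl.2 Set.subset_union_left
  have hWr : Disjoint W (closedBall 0 r) :=
    (disjoint_compl_left (a := K ∪ closedBall 0 r)).mono_right Set.subset_union_right
  have hKW : Kᶜ ⊆ W ∪ closedBall 0 r := fun z hz => by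
    by_cases h : z ∈ closedBall (0 : ℂ) r
    · exact Or.inr h
    · exact Or.inl (by rw [hW, Set.mem_compl_iff, Set.mem_union, not_or]; exact ⟨hz, h⟩)
  have key : ∀ u v : Set ℂ, IsOpen u → IsOpen v → Disjoint u v → W = u ∪ v → A ⊆ u →
      W ⊆ u := by
    intro u v hu hv huv hWuv hAu
    have hvW : v ⊆ W := hWuv ▸ Set.subset_union_right
    have hvD : Disjoint v (ball 0 1) :=
      (Disjoint.union_right (hWr.mono_left hvW) (huv.symm.mono_right hAu)).mono_right hA'
    have hcov : Kᶜ ⊆ u ∪ ball 0 1 ∪ v := by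
      intro z hz
      rcases hKW hz with h | h
      · rcases (hWuv ▸ h : z ∈ u ∪ v) with h | h
        · exact Or.inl (Or.inl h)
        · exact Or.inr h
      · exact Or.inl (Or.inr (closedBall_subset_ball hr h))
    rcases hKc.isPreconnected.subset_or_subset (hu.union isOpen_ball) hv
      (Disjoint.union_left huv hvD.symm) hcov with h | h
    · intro z hz
      rcases (hWuv ▸ hz : z ∈ u ∪ v) with hzu | hzv
      · exact hzu
      · exact ((Disjoint.union_left huv hvD.symm).le_bot ⟨h (hWK hz), hzv⟩).elim
    · have h0 : (0 : ℂ) ∈ ball (0 : ℂ) 1 := mem_ball_self one_pos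
      exact (hvD.le_bot ⟨h (hDK h0), h0⟩).elim
  refine ⟨hAc.nonempty.mono hAW, isPreconnected_iff_subset_of_disjoint.2 ?_⟩
  intro u v hu hv hWuv huv
  have hWuv' : W = W ∩ u ∪ W ∩ v := by
    rw [← Set.inter_union_distrib_left, Set.inter_eq_left.2 hWuv]
  have hdis : Disjoint (W ∩ u) (W ∩ v) := by
    rw [Set.disjoint_iff_inter_eq_empty, ← huv]
    ext z
    simp only [Set.mem_inter_iff]
    tauto
  rcases hAc.isPreconnected.subset_or_subset (hWo.inter hu) (hWo.inter hv) hdis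
    (hWuv' ▸ hAW) with h | h
  · exact Or.inl ((key _ _ (hWo.inter hu) (hWo.inter hv) hdis hWuv' h).trans
      Set.inter_subset_right)
  · exact Or.inr ((key _ _ (hWo.inter hv) (hWo.inter hu) hdis.symm
      (hWuv'.trans (Set.union_comm _ _)) h).trans Set.inter_subset_right)

/-- Polynomials divisible by a high power of `X` can be small on a disc of radius `r < 1` and close
to a given polynomial on a compact set off the unit disc. -/
theorem exists_polynomial_dvd_near {K : Set ℂ} {r ε : ℝ} (hK : IsCompact K)
    (hKc : IsConnected Kᶜ) (hd : Disjoint K unitD) (hr0 : 0 ≤ r) (hr : r < 1) (hε : 0 < ε)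
    (N : ℕ) (Q : ℂ[X]) :
    ∃ P : ℂ[X], X ^ N ∣ P ∧ (∀ z ∈ closedBall (0 : ℂ) r, ‖P.eval z‖ < ε) ∧
      ∀ z ∈ K, ‖P.eval z - Q.eval z‖ < ε := by
  classical
  have hL : IsCompact (closedBall (0 : ℂ) r) := isCompact_closedBall 0 r
  have hdL : ∀ z ∈ K, z ∉ closedBall (0 : ℂ) r := fun z hz hzL =>
    hd.le_bot ⟨hz, (closedBall_subset_ball hr hzL : z ∈ ball (0 : ℂ) 1)⟩
  set f : ℂ → ℂ := fun z => if z ∈ closedBall (0 : ℂ) r then 0 else Q.eval z / z ^ N with hf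
  have hfL : ∀ z ∈ closedBall (0 : ℂ) r, f z = 0 := fun z hz => if_pos hz
  have hfK : ∀ z, z ∉ closedBall (0 : ℂ) r → f z = Q.eval z / z ^ N := fun z hz => if_neg hz
  have hne : ∀ z, z ∉ closedBall (0 : ℂ) r → z ^ N ≠ 0 := fun z hz =>
    pow_ne_zero _ fun h => hz (by simpa [h] using hr0)
  have hdiff : ∀ z, z ∉ closedBall (0 : ℂ) r → DifferentiableAt ℂ f z := fun z hz => by
    have h1 : DifferentiableAt ℂ (fun z => Q.eval z / z ^ N) z :=
      Q.differentiableAt.div (by fun_prop) (hne z hz)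
    refine h1.congr_of_eventuallyEq ?_
    filter_upwards [isClosed_closedBall.isOpen_compl.mem_nhds hz] with w hw using hfK w hw
  have happ : PolyApprox (K ∪ closedBall 0 r) f := by
    refine polyApprox_of_continuousOn (hK.union hL)
      (isConnected_compl_union_closedBall hK.isClosed hKc hd hr0 hr) ?_ ?_
    · refine ContinuousOn.union_of_isClosed
        (fun z hz => (hdiff z (hdL z hz)).continuousAt.continuousWithinAt) ?_ hK.isClosed
        isClosed_closedBall
      exact continuousOn_const.congr hfL
    · intro z hz
      by_cases hzL : z ∈ closedBall (0 : ℂ) r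
      · refine DifferentiableAt.differentiableWithinAt ?_
        refine (differentiableAt_const (0 : ℂ)).congr_of_eventuallyEq ?_
        filter_upwards [isOpen_interior.mem_nhds hz,
          hK.isClosed.isOpen_compl.mem_nhds fun h => hdL z h hzL] with w hw hwK
        exact hfL w ((interior_subset hw).resolve_left hwK)
      · exact (hdiff z hzL).differentiableWithinAt
  obtain ⟨M, hM0, hM⟩ := (PolyApprox.polynomial (K := K ∪ closedBall 0 r)
    (X ^ N : ℂ[X])).exists_norm_le (hK.union hL)
  obtain ⟨P, hP⟩ := happ (ε / M) (by positivity)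
  have hbd : ∀ z ∈ K ∪ closedBall (0 : ℂ) r,
      ‖(X ^ N * P).eval z - z ^ N * f z‖ < ε := fun z hz => by
    have h1 := hP z hz
    have h2 := hM z hz
    rw [norm_sub_rev] at h1
    rw [eval_pow, eval_X] at h2
    rw [eval_mul, eval_pow, eval_X, ← mul_sub, norm_mul]
    calc ‖z ^ N‖ * ‖P.eval z - f z‖ ≤ M * ‖P.eval z - f z‖ := by gcongr
      _ < M * (ε / M) := by gcongr
      _ = ε := by field_simp
  refine ⟨X ^ N * P, dvd_mul_right _ _, fun z hz => ?_, fun z hz => ?_⟩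
  · have h1 := hbd z (Or.inr hz)
    rwa [hfL z hz, mul_zero, sub_zero] at h1
  · have h1 := hbd z (Or.inl hz)
    rwa [hfK z (hdL z hz), mul_div_cancel₀ _ (hne z (hdL z hz))] at h1

/-- The part of a closed ball that is off the unit disc and off finitely many balls from a fixed
countable basis of the topology. -/
def ballsRemoved (x : ℕ × Finset (ℕ × ℕ)) : Set ℂ :=
  closedBall 0 x.1 \ (unitD ∪ ⋃ i ∈ x.2, ball (TopologicalSpace.denseSeq ℂ i.1) (1 / (i.2 + 1 : ℝ)))

theorem isCompact_ballsRemoved (x : ℕ × Finset (ℕ × ℕ)) : IsCompact (ballsRemoved x) :=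
  (isCompact_closedBall 0 _).diff
    ((isOpen_ball (x := (0 : ℂ)) (ε := 1)).union (isOpen_biUnion fun _ _ => isOpen_ball))

theorem disjoint_ballsRemoved (x : ℕ × Finset (ℕ × ℕ)) : Disjoint (ballsRemoved x) unitD :=
  Set.disjoint_left.2 fun _ hz hzD => hz.2 (Or.inl hzD)

theorem exists_subset_ballsRemoved {K : Set ℂ} (hK : IsCompact K) (hKc : IsConnected Kᶜ)
    (hd : Disjoint K unitD) : ∃ x, IsConnected (ballsRemoved x)ᶜ ∧ K ⊆ ballsRemoved x := by
  obtain ⟨R, hR⟩ := hK.isBounded.subset_closedBall (0 : ℂ)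
  obtain ⟨n, hn⟩ := exists_nat_ge R
  have hKn : K ⊆ closedBall 0 n := hR.trans (closedBall_subset_closedBall hn)
  have hDK : unitD ⊆ Kᶜ := hd.subset_compl_left
  have h0D : (0 : ℂ) ∈ unitD := mem_ball_self (one_pos (α := ℝ))
  have hwn : ((n + 1 : ℝ) : ℂ) ∈ {z : ℂ | ‖z‖ ∈ Set.Ioi (n : ℝ)} := by
    rw [Set.mem_ofPred_eq, Complex.norm_real, Real.norm_of_nonneg (by positivity)]
    exact lt_add_one (n : ℝ)
  have hwK : ((n + 1 : ℝ) : ℂ) ∈ Kᶜ := fun h => by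
    have h1 := hKn h
    rw [mem_closedBall_zero_iff] at h1
    exact absurd hwn (not_lt.2 h1)
  obtain ⟨γ, hγ⟩ := (hK.isClosed.isOpen_compl.isConnected_iff_isPathConnected.1 hKc).joinedIn
    0 (hDK h0D) _ hwK
  have hcover : ∀ z ∈ Set.range γ, ∃ i : ℕ × ℕ,
      z ∈ ball (TopologicalSpace.denseSeq ℂ i.1) (1 / (i.2 + 1 : ℝ)) ∧
      ball (TopologicalSpace.denseSeq ℂ i.1) (1 / (i.2 + 1 : ℝ)) ⊆ Kᶜ := by
    rintro _ ⟨t, rfl⟩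
    obtain ⟨ε, hε, hεK⟩ := Metric.isOpen_iff.1 hK.isClosed.isOpen_compl _ (hγ t)
    obtain ⟨k, hk⟩ := exists_nat_one_div_lt (half_pos hε)
    obtain ⟨i, hi⟩ := (TopologicalSpace.denseRange_denseSeq ℂ).exists_dist_lt (γ t)
      (Nat.one_div_pos_of_nat (α := ℝ) (n := k))
    refine ⟨(i, k), hi, fun w hw => hεK ?_⟩
    rw [mem_ball] at hw ⊢
    rw [dist_comm] at hi
    linarith [dist_triangle w (TopologicalSpace.denseSeq ℂ i) (γ t)]
  choose! i hi hiK using hcover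
  obtain ⟨t, ht, htc⟩ := (isCompact_range γ.continuous).elim_nhds_subcover
    (fun z => ball (TopologicalSpace.denseSeq ℂ (i z).1) (1 / ((i z).2 + 1 : ℝ)))
    (fun z hz => isOpen_ball.mem_nhds (hi z hz))
  have h0γ : (0 : ℂ) ∈ Set.range γ := ⟨0, γ.source⟩
  have hγc : IsPreconnected (Set.range γ) := isPreconnected_range γ.continuous
  have hmem : ∀ z, z ∈ (ballsRemoved (n, t.image i))ᶜ ↔ ‖z‖ ∈ Set.Ioi (n : ℝ) ∨ z ∈ unitD ∨
      ∃ y ∈ t, z ∈ ball (TopologicalSpace.denseSeq ℂ (i y).1) (1 / ((i y).2 + 1 : ℝ)) := by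
    intro z
    simp only [ballsRemoved, Set.mem_compl_iff, Set.mem_sdiff, mem_closedBall_zero_iff,
      Set.mem_union, Set.mem_iUnion, Finset.mem_image, not_and, not_not, Set.mem_Ioi, ← not_le]
    rw [imp_iff_not_or]
    refine or_congr_right (or_congr_right ⟨?_, ?_⟩)
    · rintro ⟨_, ⟨y, hy, rfl⟩, h⟩
      exact ⟨y, hy, h⟩
    · rintro ⟨y, hy, h⟩
      exact ⟨_, ⟨y, hy, rfl⟩, h⟩
  have hγsub : Set.range γ ⊆ (ballsRemoved (n, t.image i))ᶜ := fun z hz => by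
    have h1 := htc hz
    simp only [Set.mem_iUnion, exists_prop] at h1
    exact (hmem z).2 (Or.inr (Or.inr h1))
  refine ⟨(n, t.image i), ⟨⟨0, hγsub h0γ⟩, isPreconnected_of_forall 0 fun z hz => ?_⟩, ?_⟩
  · rcases (hmem z).1 hz with h | h | ⟨y, hy, h⟩
    · exact ⟨Set.range γ ∪ {z : ℂ | ‖z‖ ∈ Set.Ioi (n : ℝ)},
        Set.union_subset hγsub fun w hw => (hmem w).2 (Or.inl hw), Or.inl h0γ, Or.inr h,
        hγc.union' ⟨_, ⟨1, γ.target⟩, hwn⟩ (isConnected_setOf_norm_mem isConnected_Ioi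
          fun s hs => n.cast_nonneg.trans (le_of_lt hs)).isPreconnected⟩
    · exact ⟨Set.range γ ∪ unitD,
        Set.union_subset hγsub fun w hw => (hmem w).2 (Or.inr (Or.inl hw)), Or.inl h0γ, Or.inr h,
        hγc.union' ⟨_, h0γ, h0D⟩ (convex_ball 0 1).isPreconnected⟩
    · exact ⟨Set.range γ ∪ ball (TopologicalSpace.denseSeq ℂ (i y).1) (1 / ((i y).2 + 1 : ℝ)),
        Set.union_subset hγsub fun w hw => (hmem w).2 (Or.inr (Or.inr ⟨y, hy, hw⟩)), Or.inl h0γ,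
        Or.inr h, hγc.union' ⟨y, ht y hy, hi y (ht y hy)⟩ (convex_ball _ _).isPreconnected⟩
  · intro z hz
    by_contra h
    rcases (hmem z).1 h with h | h | ⟨y, hy, h⟩
    · exact absurd (mem_closedBall_zero_iff.1 (hKn hz)) (not_le.2 h)
    · exact hDK h hz
    · exact hiK y (ht y hy) h hz

theorem exists_seq_polynomial_dense {K : Set ℂ} (hK : IsCompact K) :
    ∃ P : ℕ → ℂ[X], ∀ (Q : ℂ[X]) (ε : ℝ), 0 < ε → ∃ j, ∀ z ∈ K, ‖Q.eval z - (P j).eval z‖ < ε := by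
  have : CompactSpace K := isCompact_iff_compactSpace.1 hK
  obtain ⟨t, htS, htc, htd⟩ := (TopologicalSpace.IsSeparable.of_separableSpace
    (Set.range fun Q : ℂ[X] => Q.toContinuousMapOn K)).exists_countable_dense_subset
  have hne : t.Nonempty := by
    rw [← closure_nonempty_iff]
    exact (Set.range_nonempty _).mono htd
  obtain ⟨F, rfl⟩ := htc.exists_eq_range hne
  choose P hP using fun j => htS (Set.mem_range_self j)
  refine ⟨P, fun Q ε hε => ?_⟩
  obtain ⟨_, ⟨j, rfl⟩, hj⟩ := Metric.mem_closure_iff.1 (htd ⟨Q, rfl⟩) ε hε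
  refine ⟨j, fun z hz => ?_⟩
  have h1 := (ContinuousMap.dist_apply_le_dist (⟨z, hz⟩ : K)).trans_lt hj
  rw [← hP j] at h1
  simpa [dist_eq_norm] using h1

/-- Countably many approximation tasks suffice for all polynomial targets on compact sets with
connected complement off the unit disc. -/
theorem exists_seq_approximation_tasks :
    ∃ (L : ℕ → Set ℂ) (P : ℕ → ℂ[X]) (err : ℕ → ℝ),
      (∀ m, IsCompact (L m) ∧ IsConnected (L m)ᶜ ∧ Disjoint (L m) unitD ∧ 0 < err m) ∧
      ∀ K, IsCompact K → IsConnected Kᶜ → Disjoint K unitD → ∀ (Q : ℂ[X]) (ε : ℝ), 0 < ε →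
        ∃ m, K ⊆ L m ∧ err m < ε ∧ ∀ z ∈ L m, ‖Q.eval z - (P m).eval z‖ < ε := by
  choose P hP using fun x => exists_seq_polynomial_dense (isCompact_ballsRemoved x)
  let ι := {x : ℕ × Finset (ℕ × ℕ) // IsConnected (ballsRemoved x)ᶜ} × ℕ × ℕ
  have : Nonempty ι := by
    obtain ⟨x, hx, -⟩ := exists_subset_ballsRemoved isCompact_empty
      (by simpa using isConnected_univ) (Set.empty_disjoint unitD)
    exact ⟨⟨x, hx⟩, 0, 0⟩
  obtain ⟨e, he⟩ := exists_surjective_nat ι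
  refine ⟨fun m => ballsRemoved (e m).1, fun m => P (e m).1 (e m).2.1,
    fun m => 1 / ((e m).2.2 + 1 : ℝ), fun m => ⟨isCompact_ballsRemoved _, (e m).1.2,
      disjoint_ballsRemoved _, by positivity⟩, fun K hK hKc hd Q ε hε => ?_⟩
  obtain ⟨x, hx, hKx⟩ := exists_subset_ballsRemoved hK hKc hd
  obtain ⟨j, hj⟩ := hP x Q ε hε
  obtain ⟨i, hi⟩ := exists_nat_one_div_lt hε
  obtain ⟨m, hm⟩ := he (⟨x, hx⟩, j, i)
  exact ⟨m, by simpa [hm] using hKx, by simpa [hm] using hi, by simpa [hm] using hj⟩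

theorem Polynomial.iteratedDeriv_eval (P : ℂ[X]) (k : ℕ) :
    iteratedDeriv k (fun z => P.eval z) = fun z => (derivative^[k] P).eval z := by
  induction k with
  | zero => simp
  | succ k ih =>
    rw [iteratedDeriv_succ, ih, Function.iterate_succ_apply']
    ext z
    exact Polynomial.deriv _

theorem tc_polynomial (P : ℂ[X]) (k : ℕ) : tc (fun z => P.eval z) k = P.coeff k := by
  rw [tc, P.iteratedDeriv_eval]
  beta_reduce
  rw [← coeff_zero_eq_eval_zero, coeff_iterate_derivative, zero_add,
    Nat.descFactorial_self, nsmul_eq_mul, mul_div_cancel_left₀]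
  exact_mod_cast k.factorial_ne_zero

theorem TendstoLocallyUniformlyOn.tendsto_tc {F : ℕ → ℂ → ℂ} {f : ℂ → ℂ}
    (h : TendstoLocallyUniformlyOn F f atTop unitD) (hF : ∀ n, DifferentiableOn ℂ (F n) unitD)
    (k : ℕ) : Tendsto (fun n => tc (F n) k) atTop (𝓝 (tc f k)) := by
  have hD : IsOpen unitD := isOpen_ball
  have h1 : TendstoLocallyUniformlyOn (fun n => iteratedDeriv k (F n)) (iteratedDeriv k f)
      atTop unitD ∧ ∀ n, DifferentiableOn ℂ (iteratedDeriv k (F n)) unitD := by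
    induction k with
    | zero => simpa using ⟨h, hF⟩
    | succ k ih =>
      simp only [iteratedDeriv_succ]
      exact ⟨ih.1.deriv (.of_forall ih.2) hD, fun n => (ih.2 n).deriv hD⟩
  exact (h1.1.tendsto_at (mem_ball_self (one_pos (α := ℝ)) : (0 : ℂ) ∈ unitD)).div_const _

/-- Polynomials with geometrically decaying differences on discs exhausting the unit disc converge
to a holomorphic function. -/
theorem exists_hol_limit {T : ℕ → ℂ[X]} {rad : ℕ → ℝ} {ε : ℝ} (hrad : Monotone rad)
    (hrad1 : Tendsto rad atTop (𝓝 1))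
    (hT : ∀ m, ∀ z ∈ closedBall (0 : ℂ) (rad m), ‖(T (m + 1)).eval z - (T m).eval z‖ ≤
      ε / 2 / 2 ^ m) :
    ∃ f : Hol unitD, TendstoLocallyUniformlyOn (fun m z => (T m).eval z) f.1 atTop unitD ∧
      ∀ z ∈ unitD, z ∈ closedBall (0 : ℂ) (rad 0) → ‖f.1 z - (T 0).eval z‖ ≤ ε := by
  classical
  have hD : IsOpen unitD := isOpen_ball
  have hstep : ∀ m, ∀ z ∈ closedBall (0 : ℂ) (rad m), ∀ n,
      dist ((T (m + n)).eval z) ((T (m + (n + 1))).eval z) ≤ ε / 2 ^ m / 2 / 2 ^ n := by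
    intro m z hz n
    rw [dist_comm, dist_eq_norm]
    refine (hT (m + n) z (closedBall_subset_closedBall (hrad (Nat.le_add_right m n)) hz)).trans
      (le_of_eq ?_)
    rw [pow_add]
    field_simp
  have hexists : ∀ z ∈ unitD, ∃ m, ∀ᶠ w in 𝓝 z, w ∈ closedBall (0 : ℂ) (rad m) := by
    intro z hz
    obtain ⟨m, hm⟩ := (hrad1.eventually (lt_mem_nhds (mem_ball_zero_iff.1 hz))).exists
    exact ⟨m, mem_of_superset (isOpen_ball.mem_nhds (mem_ball_zero_iff.2 hm))
      ball_subset_closedBall⟩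
  have hlim : ∀ z ∈ unitD, ∃ y, Tendsto (fun m => (T m).eval z) atTop (𝓝 y) := by
    intro z hz
    obtain ⟨m, hm⟩ := hexists z hz
    obtain ⟨y, hy⟩ := cauchySeq_tendsto_of_complete
      (cauchySeq_of_le_geometric_two (hstep m z hm.self_of_nhds))
    refine ⟨y, (tendsto_add_atTop_iff_nat m).1 ?_⟩
    simpa only [add_comm] using hy
  choose! g hg using hlim
  have hbound : ∀ m, ∀ z ∈ unitD, z ∈ closedBall (0 : ℂ) (rad m) → ∀ n,
      ‖(T (m + n)).eval z - g z‖ ≤ ε / 2 ^ m / 2 ^ n := by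
    intro m z hz hzm n
    rw [← dist_eq_norm]
    refine dist_le_of_le_geometric_two_of_tendsto (hstep m z hzm) ?_ n
    have h1 := (tendsto_add_atTop_iff_nat m).2 (hg z hz)
    simpa only [add_comm] using h1
  set f : ℂ → ℂ := fun z => if z ∈ unitD then g z else 0 with hf
  have hfg : ∀ z ∈ unitD, f z = g z := fun z hz => if_pos hz
  have hloc : TendstoLocallyUniformlyOn (fun m z => (T m).eval z) f atTop unitD := by
    rw [Metric.tendstoLocallyUniformlyOn_iff]
    intro η hη z hz
    obtain ⟨m, hm⟩ := hexists z hz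
    refine ⟨{w | w ∈ closedBall (0 : ℂ) (rad m)} ∩ unitD, mem_nhdsWithin_of_mem_nhds
      (inter_mem hm (hD.mem_nhds hz)), ?_⟩
    have h1 : Tendsto (fun n : ℕ => ε / 2 ^ m / 2 ^ n) atTop (𝓝 0) :=
      tendsto_const_nhds.div_atTop (tendsto_pow_atTop_atTop_of_one_lt one_lt_two)
    obtain ⟨N, hN⟩ := eventually_atTop.1 (h1.eventually (gt_mem_nhds hη))
    filter_upwards [eventually_ge_atTop (m + N)] with n hn w hw
    obtain ⟨k, rfl⟩ := Nat.exists_eq_add_of_le hn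
    rw [hfg w hw.2, dist_comm, dist_eq_norm, add_assoc]
    exact (hbound m w hw.2 hw.1 (N + k)).trans_lt (hN _ (Nat.le_add_right N k))
  refine ⟨⟨f, hloc.differentiableOn (.of_forall fun n => (T n).differentiable.differentiableOn) hD,
    fun z hz => if_neg hz⟩, hloc, fun z hz hz0 => ?_⟩
  have h1 := hbound 0 z hz hz0 0
  simpa [norm_sub_rev, hfg z hz] using h1

theorem IsWeight.exists_gap_end {φ : ℝ → ℝ} (hφ : IsWeight φ) (p n : ℕ) :
    ∃ q : ℕ, p < q ∧ n ≤ q ∧ (p : ℝ) < φ q ∧ φ q < q := by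
  have h1 : ∀ᶠ x : ℝ in atTop, (p : ℝ) < φ x ∧ φ x / x < 1 :=
    (hφ.2.2.1.eventually_gt_atTop _).and (hφ.2.2.2.eventually (gt_mem_nhds one_pos))
  obtain ⟨q, ⟨h2, h3⟩, h4, h5⟩ := ((tendsto_natCast_atTop_atTop.eventually h1).and
    ((eventually_gt_atTop p).and (eventually_ge_atTop n))).exists
  have hq : (0 : ℝ) < q := by exact_mod_cast (Nat.zero_le p).trans_lt h4
  exact ⟨q, h4, h5, h2, by rwa [div_lt_one hq] at h3⟩

theorem exists_ne_zero_mul_pow_lt {S : Set ℂ} (hS : Bornology.IsBounded S) (n : ℕ) {ε : ℝ}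
    (hε : 0 < ε) : ∃ c : ℂ, c ≠ 0 ∧ ∀ z ∈ S, ‖c * z ^ n‖ < ε := by
  obtain ⟨B, hB0, hB⟩ := hS.exists_pos_norm_le
  refine ⟨((ε / 2 / B ^ n : ℝ) : ℂ), by exact_mod_cast (by positivity : ε / 2 / B ^ n ≠ 0),
    fun z hz => ?_⟩
  rw [norm_mul, norm_pow, Complex.norm_real, Real.norm_of_nonneg (by positivity)]
  calc ε / 2 / B ^ n * ‖z‖ ^ n ≤ ε / 2 / B ^ n * B ^ n := by gcongr; exact hB z hz
    _ = ε / 2 := by field_simp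
    _ < ε := half_lt_self hε

/-- One step of the construction: a polynomial is extended by higher powers of `X`, small on a
smaller disc, to reach a target on a compact set, with degree in the range of `μ`. -/
theorem exists_extension {μ : ℕ → ℕ} (hμ : StrictMono μ) {K : Set ℂ} {r ε η : ℝ}
    (hK : IsCompact K) (hKc : IsConnected Kᶜ) (hd : Disjoint K unitD) (hr0 : 0 ≤ r) (hr : r < 1)
    (hε : 0 < ε) (hη : 0 < η) (T Q : ℂ[X]) (i q : ℕ) (hT : T.natDegree ≤ q) :
    ∃ (T' : ℂ[X]) (i' : ℕ), i < i' ∧ q < μ i' ∧ T'.natDegree = μ i' ∧ T'.coeff (μ i') ≠ 0 ∧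
      (∀ k ≤ q, T'.coeff k = T.coeff k) ∧
      (∀ z ∈ closedBall (0 : ℂ) r, ‖T'.eval z - T.eval z‖ ≤ ε) ∧
      ∀ z ∈ K, ‖T'.eval z - Q.eval z‖ ≤ η := by
  obtain ⟨P, hdvd, hPr, hPK⟩ := exists_polynomial_dvd_near hK hKc hd hr0 hr
    (ε := min ε η / 2) (by positivity) (q + 1) (Q - T)
  obtain ⟨i', hi1, hi2, hi3⟩ : ∃ i', i < i' ∧ q < μ i' ∧ P.natDegree < μ i' := by
    obtain ⟨i', h1, h2⟩ := ((eventually_gt_atTop i).and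
      (hμ.tendsto_atTop.eventually (eventually_gt_atTop (max q P.natDegree)))).exists
    exact ⟨i', h1, (le_max_left _ _).trans_lt h2, (le_max_right _ _).trans_lt h2⟩
  obtain ⟨c, hc0, hc⟩ := exists_ne_zero_mul_pow_lt
    (hK.isBounded.union (isBounded_closedBall (x := (0 : ℂ)) (r := r))) (μ i')
    (ε := min ε η / 2) (by positivity)
  have hdeg : (T + P).natDegree < (C c * X ^ μ i').natDegree := by
    rw [natDegree_C_mul_X_pow _ _ hc0]
    exact (natDegree_add_le _ _).trans_lt (max_lt (hT.trans_lt hi2) hi3)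
  have hTP : (T + P).coeff (μ i') = 0 :=
    coeff_eq_zero_of_natDegree_lt (by rwa [natDegree_C_mul_X_pow _ _ hc0] at hdeg)
  refine ⟨T + P + C c * X ^ μ i', i', hi1, hi2, ?_, ?_, fun k hk => ?_, fun z hz => ?_,
    fun z hz => ?_⟩
  · rw [natDegree_add_eq_right_of_natDegree_lt hdeg, natDegree_C_mul_X_pow _ _ hc0]
  · rwa [coeff_add, hTP, coeff_C_mul_X_pow, if_pos rfl, zero_add]
  · rw [coeff_add, coeff_add, coeff_C_mul_X_pow, if_neg (by omega),
      X_pow_dvd_iff.1 hdvd k (by omega), add_zero, add_zero]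
  · have h1 := hPr z hz
    have h2 := hc z (Or.inr hz)
    have h3 : (T + P + C c * X ^ μ i').eval z - T.eval z = P.eval z + c * z ^ μ i' := by
      simp only [eval_add, eval_mul, eval_C, eval_pow, eval_X]
      ring
    rw [h3]
    linarith [norm_add_le (P.eval z) (c * z ^ μ i'), min_le_left ε η]
  · have h1 := hPK z hz
    have h2 := hc z (Or.inl hz)
    have h3 : (T + P + C c * X ^ μ i').eval z - Q.eval z =
        (P.eval z - (Q - T).eval z) + c * z ^ μ i' := by
      simp only [eval_add, eval_sub, eval_mul, eval_C, eval_pow, eval_X]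
      ring
    rw [h3]
    linarith [norm_add_le (P.eval z - (Q - T).eval z) (c * z ^ μ i'), min_le_right ε η]

/-- The state of the recursive construction: the current polynomial, the index in `μ` of its
degree and the end of the current gap. -/
structure GapState where
  /-- the current polynomial -/
  poly : ℂ[X]
  /-- the index in `μ` of the start of the current gap -/
  idx : ℕ
  /-- the end of the current gap -/
  gapEnd : ℕ
  natDegree_le : poly.natDegree ≤ gapEnd

theorem exists_seq_gapState {φ : ℝ → ℝ} (hφ : IsWeight φ) {μ : ℕ → ℕ} (hμ : StrictMono μ)
    {L : ℕ → Set ℂ} {rad ε η : ℕ → ℝ} (Q : ℕ → ℂ[X])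
    (hL : ∀ m, IsCompact (L m) ∧ IsConnected (L m)ᶜ ∧ Disjoint (L m) unitD)
    (hrad : ∀ m, 0 ≤ rad m ∧ rad m < 1) (hε : ∀ m, 0 < ε m) (hη : ∀ m, 0 < η m) (T₀ : ℂ[X]) :
    ∃ s : ℕ → GapState, (s 0).poly = T₀ ∧ ∀ m, (s m).idx < (s (m + 1)).idx ∧
      (s m).gapEnd < μ (s (m + 1)).idx ∧ (s (m + 1)).poly.natDegree = μ (s (m + 1)).idx ∧
      (s (m + 1)).poly.coeff (μ (s (m + 1)).idx) ≠ 0 ∧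
      (∀ k ≤ (s m).gapEnd, (s (m + 1)).poly.coeff k = (s m).poly.coeff k) ∧
      (∀ z ∈ closedBall (0 : ℂ) (rad m), ‖(s (m + 1)).poly.eval z - (s m).poly.eval z‖ ≤ ε m) ∧
      (∀ z ∈ L m, ‖(s (m + 1)).poly.eval z - (Q m).eval z‖ ≤ η m) ∧
      μ (s (m + 1)).idx < (s (m + 1)).gapEnd ∧
      m * μ (s (m + 1)).idx ≤ (s (m + 1)).gapEnd ∧
      (μ (s (m + 1)).idx : ℝ) < φ (s (m + 1)).gapEnd ∧
      φ (s (m + 1)).gapEnd < (s (m + 1)).gapEnd := by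
  have hstep : ∀ (m : ℕ) (s : GapState), ∃ t : GapState, s.idx < t.idx ∧
      s.gapEnd < μ t.idx ∧ t.poly.natDegree = μ t.idx ∧ t.poly.coeff (μ t.idx) ≠ 0 ∧
      (∀ k ≤ s.gapEnd, t.poly.coeff k = s.poly.coeff k) ∧
      (∀ z ∈ closedBall (0 : ℂ) (rad m), ‖t.poly.eval z - s.poly.eval z‖ ≤ ε m) ∧
      (∀ z ∈ L m, ‖t.poly.eval z - (Q m).eval z‖ ≤ η m) ∧
      μ t.idx < t.gapEnd ∧ m * μ t.idx ≤ t.gapEnd ∧ (μ t.idx : ℝ) < φ t.gapEnd ∧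
      φ t.gapEnd < t.gapEnd := by
    intro m s
    obtain ⟨T, i, h1, h2, h3, h4, h5, h6, h7⟩ := exists_extension hμ (hL m).1 (hL m).2.1
      (hL m).2.2 (hrad m).1 (hrad m).2 (hε m) (hη m) s.poly (Q m) s.idx s.gapEnd s.natDegree_le
    obtain ⟨q, h8, h9, h10, h11⟩ := hφ.exists_gap_end (μ i) (m * μ i)
    exact ⟨⟨T, i, q, h3.trans_le h8.le⟩, h1, h2, h3, h4, h5, h6, h7, h8, h9, h10, h11⟩
  choose next hnext using hstep
  exact ⟨fun m => m.rec ⟨T₀, 0, T₀.natDegree, le_rfl⟩ next, rfl, fun m => hnext m _⟩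

/-- Every polynomial is close, on a smaller disc, to an element of `U0set φ μ`. -/
theorem exists_mem_U0set_near {φ : ℝ → ℝ} (hφ : IsWeight φ) {μ : ℕ → ℕ} (hμ : StrictMono μ)
    (T₀ : ℂ[X]) {ρ ε : ℝ} (hρ : ρ < 1) (hε : 0 < ε) :
    ∃ f ∈ U0set φ μ, ∀ z ∈ unitD, z ∈ closedBall (0 : ℂ) ρ → ‖f.1 z - T₀.eval z‖ ≤ ε := by
  obtain ⟨L, Q, err, hL, htask⟩ := exists_seq_approximation_tasks
  set rad : ℕ → ℝ := fun m => max ρ (1 - 1 / (m + 1 : ℝ)) with hrad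
  have hrad_mono : Monotone rad := fun m n hmn => by
    simp only [hrad]
    gcongr
  have hrad1 : Tendsto rad atTop (𝓝 1) := by
    have h1 : Tendsto (fun m : ℕ => 1 - 1 / (m + 1 : ℝ)) atTop (𝓝 1) := by
      simpa using tendsto_const_nhds.sub (tendsto_one_div_add_atTop_nhds_zero_nat (𝕜 := ℝ))
    have h2 := (tendsto_const_nhds (x := ρ)).max h1
    rwa [max_eq_right hρ.le] at h2
  obtain ⟨s, hs0, hs⟩ := exists_seq_gapState hφ hμ (L := L) (rad := rad)
    (ε := fun m => ε / 2 / 2 ^ m) (η := err) Q (fun m => ⟨(hL m).1, (hL m).2.1, (hL m).2.2.1⟩)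
    (fun m => ⟨le_max_of_le_right (sub_nonneg.2 ((div_le_one (by positivity)).2 (by simp))),
      max_lt hρ (sub_lt_self _ (by positivity))⟩) (fun m => by positivity)
    (fun m => (hL m).2.2.2) T₀
  choose hidx hgap hdeg hne hcoeff hsmall hnear hlt hmul hφ1 hφ2 using hs
  obtain ⟨f, hf, hf0⟩ := exists_hol_limit (T := fun m => (s m).poly) hrad_mono hrad1 hsmall
  have hgap_lt : ∀ m, (s m).gapEnd < (s (m + 1)).gapEnd := fun m => (hgap m).trans (hlt m)
  have hcoeff_ge : ∀ m n k, m ≤ n → k ≤ (s m).gapEnd →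
      (s n).poly.coeff k = (s m).poly.coeff k := by
    intro m n k hmn hk
    induction n, hmn using Nat.le_induction with
    | base => rfl
    | succ n hn ih =>
      rw [hcoeff n k (hk.trans (monotone_nat_of_le_succ (fun m => (hgap_lt m).le) hn)), ih]
  have htc : ∀ m k, k ≤ (s m).gapEnd → tc f.1 k = (s m).poly.coeff k := by
    intro m k hk
    refine tendsto_nhds_unique (hf.tendsto_tc
      (fun n => (s n).poly.differentiable.differentiableOn) k) ?_
    refine tendsto_const_nhds.congr' ?_
    filter_upwards [eventually_ge_atTop m] with n hn
    rw [tc_polynomial, hcoeff_ge m n k hn hk]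
  have hpsum : ∀ m z, psum f.1 (μ (s (m + 1)).idx) z = (s (m + 1)).poly.eval z := by
    intro m z
    rw [psum, eval_eq_sum_range, hdeg m]
    refine Finset.sum_congr rfl fun k hk => ?_
    rw [htc (m + 1) k ((Nat.lt_succ_iff.1 (Finset.mem_range.1 hk)).trans (hlt m).le)]
  have hvanish : ∀ m k, μ (s (m + 1)).idx < k → k ≤ (s (m + 1)).gapEnd → tc f.1 k = 0 := by
    intro m k hk hk'
    rw [htc (m + 1) k hk', coeff_eq_zero_of_natDegree_lt (by rwa [hdeg m])]
  have hpos : ∀ m, 0 < μ (s (m + 1)).idx := fun m => (Nat.zero_le _).trans_lt (hgap m)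
  refine ⟨f, ⟨fun m => μ (s (m + 1)).idx, fun m => (s (m + 1)).gapEnd,
    ⟨hpos, hlt, fun m => (hgap (m + 1)).le, ?_, fun η hη => ⟨0, fun m k hk hk' _ => ?_⟩,
      fun m => ⟨hφ1 m, hφ2 m⟩,
      ⟨fun m => (s (m + 1)).idx, strictMono_nat_of_lt_succ fun m => hidx (m + 1), fun m => rfl⟩,
      fun m => ?_, hvanish⟩, fun K hK hd hKc h hh hhd => ?_⟩, fun z hz hzρ => ?_⟩
  · refine tendsto_atTop_mono (fun m => ?_) tendsto_natCast_atTop_atTop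
    rw [le_div_iff₀ (by exact_mod_cast hpos m)]
    exact_mod_cast hmul m
  · have hk0 : (k : ℝ) ≠ 0 := by exact_mod_cast ((Nat.zero_le _).trans_lt hk).ne'
    rw [hvanish m k hk hk', norm_zero, Real.zero_rpow (one_div_ne_zero hk0)]
    exact hη.le
  · rw [htc (m + 1) _ (hlt m).le]
    exact hne m
  · have happ := polyApprox_of_continuousOn hK hKc hh hhd
    have hlam : ∀ n : ℕ, ∃ m, ∀ z ∈ K, ‖psum f.1 (μ (s (m + 1)).idx) z - h z‖ <
        3 * (1 / (n + 1 : ℝ)) := by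
      intro n
      have hn : (0 : ℝ) < 1 / (n + 1 : ℝ) := by positivity
      obtain ⟨P, hP⟩ := happ _ hn
      obtain ⟨m, hKm, hm, hPm⟩ := htask K hK hKc hd P _ hn
      refine ⟨m, fun z hz => ?_⟩
      rw [hpsum, norm_sub_rev]
      have h1 := hP z hz
      have h2 := hPm z (hKm hz)
      have h3 := hnear m z (hKm hz)
      rw [norm_sub_rev] at h3
      linarith [norm_sub_le_norm_sub_add_norm_sub (h z) (P.eval z) ((s (m + 1)).poly.eval z),
        norm_sub_le_norm_sub_add_norm_sub (P.eval z) ((Q m).eval z) ((s (m + 1)).poly.eval z)]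
    choose lam hlam using hlam
    refine ⟨lam, Metric.tendstoUniformlyOn_iff.2 fun η hη => ?_⟩
    have h1 : Tendsto (fun n : ℕ => 3 * (1 / (n + 1 : ℝ))) atTop (𝓝 0) := by
      simpa using (tendsto_one_div_add_atTop_nhds_zero_nat (𝕜 := ℝ)).const_mul 3
    filter_upwards [h1.eventually (gt_mem_nhds hη)] with n hn z hz
    rw [dist_comm, dist_eq_norm]
    exact (hlam n z hz).trans hn
  · have h1 := hf0 z hz (closedBall_subset_closedBall (le_max_left _ _) hzρ)
    rwa [hs0] at h1

theorem dense_U0set {φ : ℝ → ℝ} (hφ : IsWeight φ) {μ : ℕ → ℕ} (hμ : StrictMono μ) :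
    Dense (U0set φ μ) := by
  intro g
  have hex : ∀ n : ℕ, ∃ f ∈ U0set φ μ, ∀ z ∈ unitD, z ∈ closedBall (0 : ℂ) (1 - 1 / (n + 1 : ℝ)) →
      ‖f.1 z - g.1 z‖ < 2 * (1 / (n + 1 : ℝ)) := by
    intro n
    have hn : (0 : ℝ) < 1 / (n + 1 : ℝ) := by positivity
    obtain ⟨T, hT⟩ := PolyApprox.of_differentiableOn_ball (sub_lt_self 1 hn) g.2.1 _ hn
    obtain ⟨f, hf, hfT⟩ := exists_mem_U0set_near hφ hμ T (sub_lt_self 1 hn) hn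
    refine ⟨f, hf, fun z hz hzn => ?_⟩
    have h1 := hfT z hz hzn
    have h2 := hT z hzn
    rw [norm_sub_rev] at h2
    linarith [norm_sub_le_norm_sub_add_norm_sub (f.1 z) (T.eval z) (g.1 z)]
  choose F hF hFg using hex
  refine mem_closure_of_tendsto (f := F) (b := atTop) ?_ (.of_forall hF)
  rw [nhds_induced, tendsto_comap_iff, UniformOnFun.tendsto_iff_tendstoUniformlyOn]
  intro K hK
  rw [Metric.tendstoUniformlyOn_iff]
  intro η hη
  obtain ⟨r, hr, hKr⟩ : ∃ r < (1 : ℝ), ∀ z ∈ K, ‖(z : ℂ)‖ ≤ r := by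
    rcases K.eq_empty_or_nonempty with rfl | hne
    · exact ⟨0, one_pos, by simp⟩
    · obtain ⟨x, -, hx⟩ := hK.exists_isMaxOn hne
        (f := fun z : unitD => ‖(z : ℂ)‖) (by fun_prop)
      exact ⟨‖(x : ℂ)‖, mem_ball_zero_iff.1 x.2, fun z hz => hx hz⟩
  have h0 := tendsto_one_div_add_atTop_nhds_zero_nat (𝕜 := ℝ)
  have h1 : Tendsto (fun n : ℕ => 2 * (1 / (n + 1 : ℝ))) atTop (𝓝 0) := by
    simpa using h0.const_mul 2
  filter_upwards [h1.eventually (gt_mem_nhds hη),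
    h0.eventually (gt_mem_nhds (sub_pos.2 hr))] with n hn hn' z hz
  rw [dist_comm, dist_eq_norm]
  refine (hFg n z z.2 (mem_closedBall_zero_iff.2 ?_)).trans hn
  linarith [hKr z hz]

/-- Proposition 5.4 : for every weight `φ` and every increasing sequence `μ` of
positive integers, the set `U_0^{(μ,φ)}(𝔻)` is dense in `H(𝔻)`; in particular such a
function exists. -/
theorem stmt_17 (φ : ℝ → ℝ) (hφ : IsWeight φ)
    (μ : ℕ → ℕ) (hμ : StrictMono μ) (hμpos : ∀ n, 0 < μ n) :
    Dense (U0set φ μ) ∧ ∃ f : Hol unitD, f ∈ U0set φ μ := by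
  have hd := dense_U0set hφ hμ
  exact ⟨hd, hd.nonempty⟩

end
end

section
/- Let φ be a weight, μ an increasing sequence of positive integers, and g = ∑_{k≥0} b_k z^k ∈ U_0^{(μ,φ)}(𝔻) with Ostrowski-gaps (p_m,q_m)_m. Let Z_g be the union of the zero sets of all the partial sums S_{p_m}(g), m ≥ 0. Let Q be any polynomial of degree q ≥ 1 with Q(0)=1 whose zeros lie outside 𝔻 ∪ Z_g. Then the function f := g/Q belongs to the set 𝒰_Q^μ(𝔻): for every compact K ⊂ ℂ ∖ (𝔻 ∪ Z(Q)) with connected complement and every h ∈ A(K), there is a subsequence (λ_n)_n of μ such that f ∈ 𝒩_{λ_n,q} for all n, [f; λ_n/q] → h in A(K), [f; λ_n/q] → f in H(𝔻), and the Padé denominator Q_{λ_n,q}(f) = Q for all n. -/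
open Polynomial Filter Finset Metric Topology

noncomputable section

/-- `𝒰_Q^μ(𝔻)` : the set of `f ∈ H(𝔻)` such that for every compact `K` avoiding
`𝔻 ∪ E` with connected complement, and every `h ∈ A(K)`, some subsequence
`(λ_n) = (μ (σ n))` of `μ` satisfies : a) `f ∈ 𝒩_{λ_n,q}`; b) `[f; λ_n/q] → h` in
`A(K)`; c) `[f; λ_n/q] → f` in `H(𝔻)`; d) the Padé denominator `Q_{λ_n,q}(f)` equals
the prescribed polynomial `Qp`. -/
def UQset (μ : ℕ → ℕ) (q : ℕ) (Qp : Polynomial ℂ) (E : Set ℂ) : Set (Hol unitD) :=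
  {f | ∀ K : Set ℂ, IsCompact K → Disjoint K (unitD ∪ E) → IsConnected Kᶜ →
    ∀ h : ℂ → ℂ, ContinuousOn h K → DifferentiableOn ℂ h (interior K) →
    ∃ σ : ℕ → ℕ, StrictMono σ ∧ ∃ P : ℕ → Polynomial ℂ,
      (∀ k, tc f.1 ∈ Nset (μ (σ k)) q ∧ IsPade (tc f.1) (μ (σ k)) q (P k) Qp) ∧
      TendstoUniformlyOn (fun k z => (P k).eval z / Qp.eval z) h atTop K ∧
      TendstoLocallyUniformlyOn (fun k z => (P k).eval z / Qp.eval z) f.1 atTop unitD}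
lemma tc_mul {f g : ℂ → ℂ} (hf : AnalyticAt ℂ f 0) (hg : AnalyticAt ℂ g 0) (k : ℕ) :
    tc (fun z => f z * g z) k = ∑ i ∈ Finset.range (k + 1), tc f i * tc g (k - i) := by
  unfold tc
  rw [iteratedDeriv_fun_mul hf.contDiffAt hg.contDiffAt, Finset.sum_div]
  refine Finset.sum_congr rfl fun i hi => ?_
  have hik : i ≤ k := Nat.lt_succ_iff.mp (Finset.mem_range.mp hi)
  rw [Nat.cast_choose ℂ hik]
  have h1 : (k.factorial : ℂ) ≠ 0 := mod_cast k.factorial_ne_zero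
  field_simp

lemma tc_congr {f g : ℂ → ℂ} (h : f =ᶠ[𝓝 0] g) (k : ℕ) : tc f k = tc g k := by
  unfold tc
  rw [h.iteratedDeriv_eq]

lemma tc_polynomial_s18 (Q : Polynomial ℂ) (k : ℕ) : tc (fun z => Q.eval z) k = Q.coeff k := by
  have key : ∀ n : ℕ, iteratedDeriv n (fun z => Q.eval z) =
      fun z => (derivative^[n] Q).eval z := by
    intro n
    induction n with
    | zero => simp
    | succ n ih =>
      ext z
      rw [iteratedDeriv_succ, ih, Polynomial.deriv, Function.iterate_succ_apply']
  have h1 : (k.factorial : ℂ) ≠ 0 := mod_cast k.factorial_ne_zero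
  rw [tc, key]
  beta_reduce
  rw [← Polynomial.coeff_zero_eq_eval_zero, Polynomial.coeff_iterate_derivative]
  simp only [zero_add, Nat.descFactorial_self, nsmul_eq_mul]
  field_simp

/-- The `N`-th Taylor partial sum as a polynomial. -/
def taylorPoly (f : ℂ → ℂ) (N : ℕ) : Polynomial ℂ :=
  ∑ k ∈ Finset.range (N + 1), Polynomial.C (tc f k) * Polynomial.X ^ k

lemma eval_taylorPoly (f : ℂ → ℂ) (N : ℕ) (z : ℂ) : (taylorPoly f N).eval z = psum f N z := by
  simp [taylorPoly, psum, Polynomial.eval_finsetSum]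

lemma coeff_taylorPoly (f : ℂ → ℂ) (N j : ℕ) :
    (taylorPoly f N).coeff j = if j ≤ N then tc f j else 0 := by
  simp [taylorPoly, Polynomial.finsetSum_coeff, Polynomial.coeff_C_mul, Polynomial.coeff_X_pow]

lemma natDegree_taylorPoly_le (f : ℂ → ℂ) (N : ℕ) : (taylorPoly f N).natDegree ≤ N := by
  rw [Polynomial.natDegree_le_iff_coeff_eq_zero]
  intro j hj
  rw [coeff_taylorPoly, if_neg (by omega)]

lemma tendstoLocallyUniformlyOn_psum {f : ℂ → ℂ} (hf : DifferentiableOn ℂ f unitD) :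
    TendstoLocallyUniformlyOn (psum f) f atTop unitD := by
  have hball : ∀ r : NNReal, 0 < r → r < 1 →
      TendstoLocallyUniformlyOn (fun n => psum f n) f atTop (Metric.ball 0 r) := by
    intro r hr hr1
    have hps := DifferentiableOn.hasFPowerSeriesOnBall (c := 0)
      (hf.mono (Metric.closedBall_subset_ball (by exact_mod_cast hr1))) hr
    have heq := hps.hasFPowerSeriesAt.eq_formalMultilinearSeries
      hps.hasFPowerSeriesAt.analyticAt.hasFPowerSeriesAt
    rw [heq] at hps
    have hlim := hps.tendstoLocallyUniformlyOn'
    rw [Metric.eball_coe] at hlim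
    intro u hu x hx
    obtain ⟨t, ht, hev⟩ := hlim u hu x hx
    refine ⟨t, ht, ?_⟩
    filter_upwards [(tendsto_add_atTop_nat 1).eventually hev] with n hn y hy
    convert! hn y hy using 2
    simp [psum, tc, FormalMultilinearSeries.partialSum, mul_comm]
  intro u hu x hx
  have hx1 : ‖x‖ < 1 := by simpa [unitD] using hx
  obtain ⟨r, hr, hr1⟩ := exists_between hx1
  lift r to NNReal using (norm_nonneg x).trans hr.le
  have hr0 : 0 < r := by exact_mod_cast (norm_nonneg x).trans_lt hr
  have hxr : x ∈ Metric.ball (0 : ℂ) r := by simpa using hr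
  obtain ⟨t, ht, hev⟩ := hball r hr0 (by exact_mod_cast hr1) u hu x hxr
  rw [Metric.isOpen_ball.nhdsWithin_eq hxr] at ht
  exact ⟨t, mem_nhdsWithin_of_mem_nhds ht, hev⟩

/-- If every translate `h + c` is a uniform limit of members of the sequence `F`, then `h` is
approximated by members of `F` of arbitrarily large index. -/
lemma frequently_norm_sub_lt {F : ℕ → ℂ → ℂ} {h : ℂ → ℂ} {K : Set ℂ}
    (H : ∀ c : ℂ, ∃ lam : ℕ → ℕ,
      TendstoUniformlyOn (fun n => F (lam n)) (fun z => h z + c) atTop K)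
    {ε : ℝ} (hε : 0 < ε) : ∃ᶠ m in atTop, ∀ z ∈ K, ‖F m z - h z‖ < ε := by
  rcases K.eq_empty_or_nonempty with rfl | ⟨z₀, hz₀⟩
  · simpa using (atTop_neBot : (atTop : Filter ℕ).NeBot)
  rw [frequently_atTop]
  intro N
  have hfin : ((fun i => F i z₀ - h z₀) '' Set.Iio N).Finite := (Set.finite_Iio N).image _
  obtain ⟨c, hc, hcN⟩ := ((infinite_of_mem_nhds (0 : ℂ)
    (Metric.ball_mem_nhds 0 (half_pos hε))).sdiff hfin).nonempty
  obtain ⟨lam, hlam⟩ := H c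
  have hfin' : ((fun i => F i z₀) '' Set.Iio N).Finite := (Set.finite_Iio N).image _
  have hmem : ((fun i => F i z₀) '' Set.Iio N)ᶜ ∈ 𝓝 (h z₀ + c) := by
    refine hfin'.isClosed.isOpen_compl.mem_nhds ?_
    rintro ⟨i, hi, hic⟩
    exact hcN ⟨i, hi, by simp only at hic ⊢; rw [hic]; ring⟩
  obtain ⟨n, hn1, hn2⟩ := (((hlam.tendsto_at hz₀).eventually hmem).and
    (Metric.tendstoUniformlyOn_iff.mp hlam _ (half_pos hε))).exists
  refine ⟨lam n, ?_, fun z hz => ?_⟩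
  · by_contra hlt
    exact hn1 ⟨lam n, not_le.mp hlt, rfl⟩
  · have hcε : ‖c‖ < ε / 2 := by simpa using hc
    have hd := hn2 z hz
    rw [dist_comm, dist_eq_norm] at hd
    calc ‖F (lam n) z - h z‖ = ‖(F (lam n) z - (h z + c)) + c‖ := by ring_nf
      _ ≤ ‖F (lam n) z - (h z + c)‖ + ‖c‖ := norm_add_le _ _
      _ < ε := by linarith

lemma hankelDet_ne_zero_of_isPade {a : ℕ → ℂ} {m n : ℕ} {P Q : Polynomial ℂ}
    (h : IsPade a m n P Q) (hQ : Q.natDegree = n) : hankelDet a m n ≠ 0 := by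
  obtain ⟨hP, -, hcop, hQ0, hcoef⟩ := h
  have hQne : Q ≠ 0 := by rintro rfl; simp at hQ0
  intro hdet
  obtain ⟨v, hv, hker⟩ := Matrix.exists_mulVec_eq_zero_iff.mpr hdet
  set R : Polynomial ℂ := ∑ j : Fin n, Polynomial.monomial (n - 1 - (j : ℕ)) (v j) with hR
  have hRdeg : R.degree < n := by
    rw [Polynomial.degree_lt_iff_coeff_zero]
    intro d hd
    rw [hR, Polynomial.finsetSum_coeff]
    refine Finset.sum_eq_zero fun j _ => ?_
    have := j.2
    rw [Polynomial.coeff_monomial, if_neg (by omega)]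
  have hRcoeff : ∀ j : Fin n, R.coeff (n - 1 - (j : ℕ)) = v j := by
    intro j
    rw [hR, Polynomial.finsetSum_coeff, Finset.sum_eq_single j]
    · simp
    · intro i _ hij
      rw [Polynomial.coeff_monomial, if_neg]
      intro he
      apply hij
      have := i.2
      have := j.2
      ext
      omega
    · simp
  set F : PowerSeries ℂ := PowerSeries.mk a with hF
  have hRF : ∀ i < n, PowerSeries.coeff (m + i) ((R : PowerSeries ℂ) * F) = 0 := by
    intro i hi
    have hk := congrFun hker ⟨i, hi⟩
    simp only [Matrix.mulVec, dotProduct, Matrix.of_apply, Pi.zero_apply] at hk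
    rw [← hk]
    have hcoe : (R : PowerSeries ℂ) =
        ∑ j : Fin n, PowerSeries.C (v j) * PowerSeries.X ^ (n - 1 - (j : ℕ)) := by
      rw [hR]
      ext d
      simp [Polynomial.coeff_coe, Polynomial.finsetSum_coeff, Polynomial.coeff_monomial,
        PowerSeries.coeff_C_mul, PowerSeries.coeff_X_pow, eq_comm]
    rw [hcoe, Finset.sum_mul, map_sum]
    refine Finset.sum_congr rfl fun j _ => ?_
    have hj := j.2
    rw [mul_assoc, PowerSeries.coeff_C_mul, mul_comm,
      PowerSeries.coeff_X_pow_mul']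
    congr 1
    unfold acoefZ
    by_cases hle : n - 1 - (j : ℕ) ≤ m + i
    · rw [if_pos hle, if_pos (by omega), hF, PowerSeries.coeff_mk]
      congr 1
      omega
    · rw [if_neg hle, if_neg (by omega)]
  set U : Polynomial ℂ := PowerSeries.trunc m ((R : PowerSeries ℂ) * F) with hU
  have hUR : (PowerSeries.X : PowerSeries ℂ) ^ (m + n) ∣ (U : PowerSeries ℂ) - R * F := by
    rw [PowerSeries.X_pow_dvd_iff]
    intro d hd
    rw [map_sub, Polynomial.coeff_coe, hU, PowerSeries.coeff_trunc]
    split_ifs with hdm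
    · simp
    · obtain ⟨i, rfl⟩ := Nat.exists_eq_add_of_le (not_lt.mp hdm)
      rw [hRF i (by omega), sub_zero]
  have hQF : (PowerSeries.X : PowerSeries ℂ) ^ (m + n) ∣ (Q : PowerSeries ℂ) * F - P := by
    rw [PowerSeries.X_pow_dvd_iff]
    intro d hd
    rw [map_sub, Polynomial.coeff_coe, ← hcoef d hd.le, PowerSeries.coeff_mul,
      Finset.Nat.sum_antidiagonal_eq_sum_range_succ
        (fun i j => PowerSeries.coeff i (Q : PowerSeries ℂ) * PowerSeries.coeff j F)]
    simp [hF]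
  have hdvd : (PowerSeries.X : PowerSeries ℂ) ^ (m + n) ∣
      ((Q * U - R * P : Polynomial ℂ) : PowerSeries ℂ) := by
    have : ((Q * U - R * P : Polynomial ℂ) : PowerSeries ℂ) =
        Q * ((U : PowerSeries ℂ) - R * F) + R * ((Q : PowerSeries ℂ) * F - P) := by
      push_cast
      ring
    rw [this]
    exact dvd_add (hUR.mul_left _) (hQF.mul_left _)
  have hdegQU : (Q * U).degree < (m + n : ℕ) := by
    rw [Polynomial.degree_mul, Polynomial.degree_eq_natDegree hQne, hQ, add_comm, Nat.cast_add]
    exact WithBot.add_lt_add_right (WithBot.coe_ne_bot) (PowerSeries.degree_trunc_lt _ _)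
  have hdegRP : (R * P).degree < (m + n : ℕ) := by
    rw [Polynomial.degree_mul, add_comm, Nat.cast_add]
    exact (add_le_add (Polynomial.degree_le_of_natDegree_le hP) le_rfl).trans_lt
      (WithBot.add_lt_add_left WithBot.coe_ne_bot hRdeg)
  have hzero : Q * U - R * P = 0 := by
    ext d
    rcases lt_or_ge d (m + n) with hd | hd
    · rw [← Polynomial.coeff_coe, PowerSeries.X_pow_dvd_iff.mp hdvd d hd, Polynomial.coeff_zero]
    · refine Polynomial.coeff_eq_zero_of_degree_lt ?_
      refine ((Polynomial.degree_sub_le _ _).trans_lt (max_lt hdegQU hdegRP)).trans_le ?_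
      exact_mod_cast hd
  have hQR : Q ∣ R := hcop.symm.dvd_of_dvd_mul_right ⟨U, (sub_eq_zero.mp hzero).symm⟩
  have hR0 : R = 0 := by
    refine Polynomial.eq_zero_of_dvd_of_degree_lt hQR ?_
    rwa [Polynomial.degree_eq_natDegree hQne, hQ]
  apply hv
  ext j
  rw [← hRcoeff j, hR0]
  simp

lemma isPade_taylorPoly {f g : ℂ → ℂ} {m : ℕ} {Q : Polynomial ℂ} (hf : AnalyticAt ℂ f 0)
    (hfg : (fun z => Q.eval z * f z) =ᶠ[𝓝 0] g) (hQ0 : Q.coeff 0 = 1)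
    (hgap : ∀ k, m < k → k ≤ m + Q.natDegree → tc g k = 0)
    (hroots : ∀ z, Q.eval z = 0 → psum g m z ≠ 0) :
    IsPade (tc f) m Q.natDegree (taylorPoly g m) Q := by
  refine ⟨natDegree_taylorPoly_le g m, le_rfl, ?_, hQ0, fun j hj => ?_⟩
  · rw [Polynomial.isCoprime_iff_aeval_ne_zero_of_isAlgClosed ℂ ℂ]
    intro z
    simp only [Polynomial.coe_aeval_eq_eval, eval_taylorPoly]
    by_cases hz : Q.eval z = 0
    · exact Or.inl (hroots z hz)
    · exact Or.inr hz
  · have hQan : AnalyticAt ℂ (fun z => Q.eval z) 0 := by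
      exact Q.differentiable.analyticAt 0
    have hmul := tc_mul hQan hf j
    rw [tc_congr hfg] at hmul
    simp only [tc_polynomial_s18] at hmul
    rw [← hmul, coeff_taylorPoly]
    split_ifs with hjm
    · rfl
    · exact hgap j (not_le.mp hjm) hj

lemma U0Gaps.strictMono {φ : ℝ → ℝ} {μ : ℕ → ℕ} {f : ℂ → ℂ} {p q : ℕ → ℕ}
    (h : U0Gaps φ μ f p q) : StrictMono p :=
  strictMono_nat_of_lt_succ fun m => (h.2.1 m).trans_le (h.2.2.1 m)

lemma U0Gaps.eventually_add_le {φ : ℝ → ℝ} {μ : ℕ → ℕ} {f : ℂ → ℂ} {p q : ℕ → ℕ}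
    (h : U0Gaps φ μ f p q) (n : ℕ) : ∀ᶠ m in atTop, p m + n ≤ q m := by
  filter_upwards [h.2.2.2.1.eventually_ge_atTop 2, eventually_ge_atTop n] with m hm hnm
  have hp : (0 : ℝ) < p m := by exact_mod_cast h.1 m
  rw [le_div_iff₀ hp] at hm
  have hq : 2 * p m ≤ q m := by exact_mod_cast hm
  have := h.strictMono.le_apply (x := m)
  omega

lemma tendstoLocallyUniformlyOn_eval_div {g u : ℂ → ℂ} {N : ℕ → ℕ} {s : Set ℂ}
    {Q : Polynomial ℂ}
    (h : TendstoLocallyUniformlyOn (fun k => psum g (N k)) u atTop s)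
    (hu : ContinuousOn u s) (hQ : ∀ z ∈ s, Q.eval z ≠ 0) :
    TendstoLocallyUniformlyOn (fun k z => (taylorPoly g (N k)).eval z / Q.eval z)
      (fun z => u z / Q.eval z) atTop s := by
  have hinv : TendstoLocallyUniformlyOn (fun (_ : ℕ) z => (Q.eval z)⁻¹)
      (fun z => (Q.eval z)⁻¹) atTop s := fun v hv _ _ =>
    ⟨s, self_mem_nhdsWithin, Eventually.of_forall fun _ _ _ => refl_mem_uniformity hv⟩
  simp only [eval_taylorPoly, div_eq_mul_inv]
  exact h.fun_mul₀ hinv hu (Q.continuous.continuousOn.inv₀ hQ)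

/-- Proposition 5.6 : let `g ∈ U_0^{(μ,φ)}(𝔻)` with Ostrowski-gaps `(p_m, q_m)_m`, let
`Z_g` be the union of the zero sets of the partial sums `S_{p_m}(g)`, and let `Qp` be a
polynomial of degree `≥ 1` with `Qp(0) = 1` whose zeros lie outside `𝔻 ∪ Z_g`. Then
`f := g/Qp` belongs to `𝒰_{Qp}^μ(𝔻)`. -/
theorem stmt_18 (φ : ℝ → ℝ) (hφ : IsWeight φ)
    (μ : ℕ → ℕ) (hμ : StrictMono μ) (hμpos : ∀ n, 0 < μ n)
    (g : Hol unitD) (p q : ℕ → ℕ) (hgaps : U0Gaps φ μ g.1 p q)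
    (huniv : ∀ K : Set ℂ, IsCompact K → Disjoint K unitD → IsConnected Kᶜ →
      ∀ h : ℂ → ℂ, ContinuousOn h K → DifferentiableOn ℂ h (interior K) →
      ∃ lam : ℕ → ℕ,
        TendstoUniformlyOn (fun n z => psum g.1 (p (lam n)) z) h atTop K)
    (Qp : Polynomial ℂ) (hdeg : 1 ≤ Qp.natDegree) (hQ0 : Qp.coeff 0 = 1)
    (hzeros : ∀ z : ℂ, Qp.eval z = 0 → 1 ≤ ‖z‖ ∧ ∀ m, psum g.1 (p m) z ≠ 0) :
    ∃ f : Hol unitD, (∀ z ∈ unitD, f.1 z = g.1 z / Qp.eval z) ∧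
      f ∈ UQset μ Qp.natDegree Qp {z : ℂ | Qp.eval z = 0} := by
  have hQD : ∀ z ∈ unitD, Qp.eval z ≠ 0 := fun z hz h0 =>
    absurd (hzeros z h0).1 (not_le.mpr (by simpa [unitD] using hz))
  have hDopen : IsOpen unitD := Metric.isOpen_ball
  have h0D : (0 : ℂ) ∈ unitD := Metric.mem_ball_self one_pos
  classical
  set f : ℂ → ℂ := fun z => if z ∈ unitD then g.1 z / Qp.eval z else 0 with hf
  have hfD : ∀ z ∈ unitD, f z = g.1 z / Qp.eval z := fun z hz => if_pos hz
  have hfdiff : DifferentiableOn ℂ f unitD :=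
    (g.2.1.div Qp.differentiable.differentiableOn hQD).congr hfD
  refine ⟨⟨f, hfdiff, fun z hz => if_neg hz⟩, hfD, ?_⟩
  intro K hK hKdisj hKconn h hcont hdiff
  have hKD : Disjoint K unitD := hKdisj.mono_right Set.subset_union_left
  have hQK : ∀ z ∈ K, Qp.eval z ≠ 0 := fun z hz h0 =>
    Set.disjoint_left.mp hKdisj hz (Or.inr h0)
  have hfg : (fun z => Qp.eval z * f z) =ᶠ[𝓝 0] g.1 := by
    filter_upwards [hDopen.mem_nhds h0D] with z hz
    rw [hfD z hz, mul_div_cancel₀ _ (hQD z hz)]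
  have hpade : ∀ᶠ m in atTop, IsPade (tc f) (p m) Qp.natDegree (taylorPoly g.1 (p m)) Qp := by
    filter_upwards [hgaps.eventually_add_le Qp.natDegree] with m hm
    exact isPade_taylorPoly (hfdiff.analyticAt (hDopen.mem_nhds h0D)) hfg hQ0
      (fun k hk hk' => hgaps.2.2.2.2.2.2.2.2 m k hk (hk'.trans hm)) fun z hz => (hzeros z hz).2 m
  have happrox : ∀ ε : ℝ, 0 < ε →
      ∃ᶠ m in atTop, ∀ z ∈ K, ‖psum g.1 (p m) z - h z * Qp.eval z‖ < ε := by
    intro ε hε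
    refine frequently_norm_sub_lt (F := fun m => psum g.1 (p m)) (fun c => ?_) hε
    exact huniv K hK hKD hKconn _
      ((hcont.mul Qp.continuous.continuousOn).add continuousOn_const)
      ((hdiff.mul Qp.differentiable.differentiableOn).add (differentiableOn_const c))
  obtain ⟨τ, hτ, hτP⟩ := extraction_forall_of_frequently fun n : ℕ =>
    (happrox (1 / ((n : ℝ) + 1)) Nat.one_div_pos_of_nat).and_eventually hpade
  obtain ⟨σ, hσ, hpσ⟩ := hgaps.2.2.2.2.2.2.1
  refine ⟨σ ∘ τ, hσ.comp hτ, fun k => taylorPoly g.1 (p (τ k)), fun k => ?_, ?_, ?_⟩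
  · have hk := (hτP k).2
    simp only [Function.comp_apply, ← hpσ]
    refine ⟨⟨hankelDet_ne_zero_of_isPade hk rfl, _, _, hk, ?_⟩, hk⟩
    exact Polynomial.degree_eq_natDegree (by rintro rfl; simp at hQ0)
  · have hlim : TendstoUniformlyOn (fun k => psum g.1 (p (τ k)))
        (fun z => h z * Qp.eval z) atTop K := by
      rw [Metric.tendstoUniformlyOn_iff]
      intro ε hε
      filter_upwards [tendsto_one_div_add_atTop_nhds_zero_nat.eventually_lt_const hε]
        with k hk z hz
      rw [dist_comm, dist_eq_norm]
      exact ((hτP k).1 z hz).trans hk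
    rw [← tendstoLocallyUniformlyOn_iff_tendstoUniformlyOn_of_compact hK] at hlim ⊢
    refine (tendstoLocallyUniformlyOn_eval_div hlim (hcont.mul Qp.continuous.continuousOn)
      hQK).congr_right fun z hz => ?_
    exact mul_div_cancel_right₀ _ (hQK z hz)
  · have hlim : TendstoLocallyUniformlyOn (fun k => psum g.1 (p (τ k))) g.1 atTop unitD := by
      intro u hu x hx
      obtain ⟨t, ht, hev⟩ := tendstoLocallyUniformlyOn_psum g.2.1 u hu x hx
      exact ⟨t, ht, (hgaps.strictMono.comp hτ).tendsto_atTop.eventually hev⟩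
    exact (tendstoLocallyUniformlyOn_eval_div hlim g.2.1.continuousOn hQD).congr_right
      fun z hz => (hfD z hz).symm

end
end
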